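/- Fix positive integers a, b, c with gcd(a,b,c) = 1. The form f(x,y,z) = a·x² + b·t_y + c·t_z (x, y, z ∈ ℕ) is asymptotically universal if and only if both of the following hold: (1) −bc R a′, −2ac R b′, and −2ab R c′; (2) either 4 ∤ b or 4 ∤ c. -/

import Mathlib

/-- The `k`-th triangular number. -/
def triangular (k : ℕ) : ℕ := k * (k + 1) / 2

/-- The odd part `m'` of `m`, i.e. `m = 2^(v₂ m) * m'` with `m'` odd. -/
def oddPart (m : ℕ) : ℕ := m / 2 ^ (m.factorization 2)

/-- `d R m` : the Legendre symbol `(d/p)` equals `1` for every prime `p ∣ m`. -/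
def isQR (d : ℤ) (m : ℕ) : Prop :=
  ∀ p : ℕ, (hp : p.Prime) → p ∣ m → @legendreSym p ⟨hp⟩ d = 1

/-- A solvability predicate is asymptotically universal if its exceptional set
has asymptotic density zero. -/
def AsympUniversal (sol : ℕ → Prop) : Prop :=
  Filter.Tendsto (fun N : ℕ => ({n : ℕ | n < N ∧ ¬ sol n}.ncard : ℝ) / N)
    Filter.atTop (nhds 0)

/-! ### Local solutions -/

/-- The solutions in `R` of `α x² + β (y² + y) + γ (z² + z) = ν`. -/
def triSol {R : Type*} [CommRing R] (α β γ ν : R) : Set (R × R × R) :=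
  {v | α * v.1 ^ 2 + β * (v.2.1 ^ 2 + v.2.1) + γ * (v.2.2 ^ 2 + v.2.2) = ν}

/-- The nonsingular solutions in `R` of `α x² + β (y² + y) + γ (z² + z) = ν`. -/
def nsTriSol {R : Type*} [CommRing R] (α β γ ν : R) : Set (R × R × R) :=
  {v | v ∈ triSol α β γ ν ∧
    (2 * α * v.1 ≠ 0 ∨ β * (2 * v.2.1 + 1) ≠ 0 ∨ γ * (2 * v.2.2 + 1) ≠ 0)}

lemma exists_lift_quadratic {R F : Type*} [CommRing R] [Finite R] [Field F] (π : R →+* F)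
    (hu : ∀ r, π r ≠ 0 → IsUnit r) (α β s t : R) (hs : π (2 * α * s + β) ≠ 0)
    (ht : π t = π (α * s ^ 2 + β * s)) : ∃ z, π z = π s ∧ α * z ^ 2 + β * z = t := by
  let h : RingHom.ker π → RingHom.ker π := fun u =>
    ⟨u.1 * (α * (2 * s + u.1) + β), Ideal.mul_mem_right _ _ u.2⟩
  have hinj : Function.Injective h := by
    rintro ⟨u, hu'⟩ ⟨w, hw'⟩ huw
    have h1 : u * (α * (2 * s + u) + β) = w * (α * (2 * s + w) + β) := by
      simpa [h] using huw
    have h2 : (u - w) * (2 * α * s + β + α * (u + w)) = 0 := by linear_combination h1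
    have h3 : IsUnit (2 * α * s + β + α * (u + w)) := by
      apply hu
      rw [RingHom.mem_ker] at hu' hw'
      rw [map_add, map_mul π α, map_add π u, hu', hw']
      simpa using hs
    have h4 := (h3.mul_left_eq_zero).1 h2
    exact Subtype.ext (sub_eq_zero.1 h4)
  have hsurj := Finite.surjective_of_injective hinj
  obtain ⟨⟨u, hu'⟩, hu2⟩ := hsurj ⟨t - (α * s ^ 2 + β * s), by
    rw [RingHom.mem_ker, map_sub, ht, sub_self]⟩
  have h1 : u * (α * (2 * s + u) + β) = t - (α * s ^ 2 + β * s) := by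
    simpa [h] using hu2
  refine ⟨s + u, ?_, by linear_combination h1⟩
  rw [RingHom.mem_ker] at hu'
  rw [map_add, hu', add_zero]

lemma card_nsTriSol_mul_le {R F : Type*} [CommRing R] [Finite R] [Field F] [Finite F]
    (π : R →+* F) (hπ : Function.Surjective π) (hu : ∀ r, π r ≠ 0 → IsUnit r)
    (α β γ ν : R) :
    Nat.card (nsTriSol (π α) (π β) (π γ) (π ν)) * Nat.card R ^ 2 ≤
      Nat.card (triSol α β γ ν) * Nat.card F ^ 2 := by
  classical
  obtain ⟨σ, hσ⟩ := hπ.hasRightInverse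
  let K := RingHom.ker π
  have hK : ∀ k : K, π k.1 = 0 := fun k => k.2
  have key : ∀ d : nsTriSol (π α) (π β) (π γ) (π ν) × K × K, ∃ w : triSol α β γ ν,
      (π w.1.1, π w.1.2.1, π w.1.2.2) = d.1.1 ∧
      ((2 * π α * d.1.1.1 ≠ 0 ∧ w.1.2.1 = σ d.1.1.2.1 + d.2.1 ∧
          w.1.2.2 = σ d.1.1.2.2 + d.2.2) ∨
        (¬ (2 * π α * d.1.1.1 ≠ 0) ∧ π β * (2 * d.1.1.2.1 + 1) ≠ 0 ∧
          w.1.1 = σ d.1.1.1 + d.2.1 ∧ w.1.2.2 = σ d.1.1.2.2 + d.2.2) ∨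
        (¬ (2 * π α * d.1.1.1 ≠ 0) ∧ ¬ (π β * (2 * d.1.1.2.1 + 1) ≠ 0) ∧
          w.1.1 = σ d.1.1.1 + d.2.1 ∧ w.1.2.1 = σ d.1.1.2.1 + d.2.2)) := by
    rintro ⟨⟨⟨x, y, z⟩, hsol, hns⟩, k, l⟩
    simp only [triSol, Set.mem_ofPred_eq] at hsol hns
    have hk := hK k
    have hl := hK l
    by_cases h1 : 2 * π α * x ≠ 0
    · obtain ⟨x', hx', hx2⟩ := exists_lift_quadratic π hu α 0 (σ x)
        (ν - β * ((σ y + k) ^ 2 + (σ y + k)) - γ * ((σ z + l) ^ 2 + (σ z + l)))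
        (by simpa [hσ x, map_ofNat] using h1) (by
          simp only [map_sub, map_mul, map_add, map_pow, hσ _, hk, hl, map_zero, ← hsol]; ring)
      exact ⟨⟨(x', σ y + k, σ z + l), by
        simp only [triSol, Set.mem_ofPred_eq]; linear_combination hx2⟩,
        by simp [hx', hσ _, hk, hl], Or.inl ⟨h1, rfl, rfl⟩⟩
    by_cases h2 : π β * (2 * y + 1) ≠ 0
    · obtain ⟨y', hy', hy2⟩ := exists_lift_quadratic π hu β β (σ y)
        (ν - α * (σ x + k) ^ 2 - γ * ((σ z + l) ^ 2 + (σ z + l)))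
        (by
          have : π (2 * β * σ y + β) = π β * (2 * y + 1) := by
            simp only [map_mul, map_add, hσ _, map_ofNat]; ring
          rwa [this]) (by
          simp only [map_sub, map_mul, map_add, map_pow, hσ _, hk, hl, ← hsol]; ring)
      exact ⟨⟨(σ x + k, y', σ z + l), by
        simp only [triSol, Set.mem_ofPred_eq]; linear_combination hy2⟩,
        by simp [hy', hσ _, hk, hl], Or.inr (Or.inl ⟨h1, h2, rfl, rfl⟩)⟩
    · have h3 : π γ * (2 * z + 1) ≠ 0 := by tauto
      obtain ⟨z', hz', hz2⟩ := exists_lift_quadratic π hu γ γ (σ z)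
        (ν - α * (σ x + k) ^ 2 - β * ((σ y + l) ^ 2 + (σ y + l)))
        (by
          have : π (2 * γ * σ z + γ) = π γ * (2 * z + 1) := by
            simp only [map_mul, map_add, hσ _, map_ofNat]; ring
          rwa [this]) (by
          simp only [map_sub, map_mul, map_add, map_pow, hσ _, hk, hl, ← hsol]; ring)
      exact ⟨⟨(σ x + k, σ y + l, z'), by
        simp only [triSol, Set.mem_ofPred_eq]; linear_combination hz2⟩,
        by simp [hz', hσ _, hk, hl], Or.inr (Or.inr ⟨h1, h2, rfl, rfl⟩)⟩
  choose f hf1 hf2 using key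
  have hinj : Function.Injective f := by
    intro d d' hdd
    have hv : d.1 = d'.1 := Subtype.ext (by rw [← hf1, ← hf1, hdd])
    obtain ⟨v, k, l⟩ := d
    obtain ⟨v', k', l'⟩ := d'
    obtain rfl : v = v' := hv
    have h1 := hf2 (v, k, l)
    have h2 := hf2 (v, k', l')
    rw [hdd] at h1
    have : k.1 = k'.1 ∧ l.1 = l'.1 := by
      rcases h1 with ⟨c1, p1, q1⟩ | ⟨c1, c2, p1, q1⟩ | ⟨c1, c2, p1, q1⟩ <;>
      rcases h2 with ⟨c1', p2, q2⟩ | ⟨c1', c2', p2, q2⟩ | ⟨c1', c2', p2, q2⟩ <;>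
      first
      | exact absurd c1 c1'
      | exact absurd c1' c1
      | exact absurd c2 c2'
      | exact absurd c2' c2
      | exact ⟨add_left_cancel (p1.symm.trans p2), add_left_cancel (q1.symm.trans q2)⟩
    rw [Subtype.ext this.1, Subtype.ext this.2]
  have hcard := Nat.card_le_card_of_injective f hinj
  rw [Nat.card_prod, Nat.card_prod] at hcard
  have hR : Nat.card R ≤ Nat.card F * Nat.card K := by
    rw [← Nat.card_prod]
    refine Nat.card_le_card_of_injective
      (fun r => (π r, (⟨r - σ (π r), by rw [RingHom.mem_ker, map_sub, hσ, sub_self]⟩ : K))) ?_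
    intro r r' h
    simp only [Prod.mk.injEq, Subtype.mk.injEq] at h
    have := h.2
    rw [h.1] at this
    exact sub_left_injective this
  calc _ ≤ Nat.card (nsTriSol (π α) (π β) (π γ) (π ν)) * (Nat.card F * Nat.card K) ^ 2 := by
        gcongr
    _ = Nat.card (nsTriSol (π α) (π β) (π γ) (π ν)) * (Nat.card K * Nat.card K)
          * Nat.card F ^ 2 := by ring
    _ ≤ _ := by gcongr

lemma card_linear_eq_zero_le {F : Type*} [Field F] [Finite F] (a b c : F)
    (h : a ≠ 0 ∨ b ≠ 0 ∨ c ≠ 0) :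
    Nat.card {w : F × F × F // a * w.1 + b * w.2.1 + c * w.2.2 = 0} ≤ Nat.card F ^ 2 := by
  rw [sq, ← Nat.card_prod]
  rcases h with h | h | h
  · refine Nat.card_le_card_of_injective (fun w => (w.1.2.1, w.1.2.2)) ?_
    rintro ⟨⟨x, y, z⟩, hw⟩ ⟨⟨x', y', z'⟩, hw'⟩ heq
    simp only [Prod.mk.injEq, Subtype.mk.injEq] at heq hw hw' ⊢
    obtain ⟨rfl, rfl⟩ := heq
    exact ⟨mul_left_cancel₀ h (by linear_combination hw - hw'), rfl, rfl⟩
  · refine Nat.card_le_card_of_injective (fun w => (w.1.1, w.1.2.2)) ?_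
    rintro ⟨⟨x, y, z⟩, hw⟩ ⟨⟨x', y', z'⟩, hw'⟩ heq
    simp only [Prod.mk.injEq, Subtype.mk.injEq] at heq hw hw' ⊢
    obtain ⟨rfl, rfl⟩ := heq
    exact ⟨rfl, mul_left_cancel₀ h (by linear_combination hw - hw'), rfl⟩
  · refine Nat.card_le_card_of_injective (fun w => (w.1.1, w.1.2.1)) ?_
    rintro ⟨⟨x, y, z⟩, hw⟩ ⟨⟨x', y', z'⟩, hw'⟩ heq
    simp only [Prod.mk.injEq, Subtype.mk.injEq] at heq hw hw' ⊢
    obtain ⟨rfl, rfl⟩ := heq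
    exact ⟨rfl, rfl, mul_left_cancel₀ h (by linear_combination hw - hw')⟩

/-- A diagonal ternary form with a nonsingular isotropic vector represents every element of a
finite field of odd characteristic at least `q² - q` times, nonsingularly. -/
lemma card_nsTriSol_ge {F : Type*} [Field F] [Finite F] (h2 : (2 : F) ≠ 0) (α β γ ν : F)
    (e : F × F × F) (he : α * e.1 ^ 2 + β * e.2.1 ^ 2 + γ * e.2.2 ^ 2 = 0)
    (hns : α * e.1 ≠ 0 ∨ β * e.2.1 ≠ 0 ∨ γ * e.2.2 ≠ 0) :
    Nat.card F ^ 2 ≤ Nat.card (nsTriSol α β γ ν) + Nat.card F := by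
  classical
  obtain ⟨e₁, e₂, e₃⟩ := e
  simp only at he hns
  let l : F × F × F → F := fun w => α * e₁ * w.1 + β * e₂ * w.2.1 + γ * e₃ * w.2.2
  let m : F := 4 * ν + β + γ
  let lam : F × F × F → F := fun w =>
    (m - (α * w.1 ^ 2 + β * w.2.1 ^ 2 + γ * w.2.2 ^ 2)) / (2 * l w)
  have hlam : ∀ w, l w ≠ 0 →
      2 * lam w * l w = m - (α * w.1 ^ 2 + β * w.2.1 ^ 2 + γ * w.2.2 ^ 2) := by
    intro w hw
    simp only [lam]
    field_simp
  let g : {w // ¬ l w = 0} → F × nsTriSol α β γ ν := fun w =>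
    (lam w.1, ⟨((w.1.1 + lam w.1 * e₁) / 2, (w.1.2.1 + lam w.1 * e₂ - 1) / 2,
      (w.1.2.2 + lam w.1 * e₃ - 1) / 2), by
        have h := hlam w.1 w.2
        have hl : l w.1 ≠ 0 := w.2
        obtain ⟨⟨x, y, z⟩, hw⟩ := w
        simp only at h hl
        set t := lam (x, y, z)
        simp only [l, m] at h hl
        constructor
        · simp only [triSol, Set.mem_ofPred_eq]
          field_simp
          linear_combination h + t ^ 2 * he
        · by_contra! hcon
          obtain ⟨p1, p2, p3⟩ := hcon
          have q1 : α * (x + t * e₁) = 0 := by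
            rw [← p1]; field_simp
          have q2 : β * (y + t * e₂) = 0 := by
            rw [← p2]; field_simp; ring
          have q3 : γ * (z + t * e₃) = 0 := by
            rw [← p3]; field_simp; ring
          apply hl
          linear_combination e₁ * q1 + e₂ * q2 + e₃ * q3 - t * he⟩)
  have hg : Function.Injective g := by
    rintro ⟨⟨x, y, z⟩, hw⟩ ⟨⟨x', y', z'⟩, hw'⟩ heq
    simp only [g, Prod.mk.injEq, Subtype.mk.injEq] at heq
    obtain ⟨h0, h1, h3, h4⟩ := heq
    rw [h0] at h1 h3 h4
    field_simp at h1 h3 h4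
    simp only [Subtype.mk.injEq, Prod.mk.injEq]
    exact ⟨by linear_combination h1, by linear_combination h3, by linear_combination h4⟩
  have c1 := Nat.card_le_card_of_injective g hg
  rw [Nat.card_prod] at c1
  have c2 := card_linear_eq_zero_le (α * e₁) (β * e₂) (γ * e₃) hns
  have c3 : Nat.card {w // l w = 0} + Nat.card {w // ¬ l w = 0} = Nat.card F ^ 3 := by
    rw [← Nat.card_sum, Nat.card_congr (Equiv.sumCompl fun w => l w = 0), Nat.card_prod,
      Nat.card_prod]
    ring
  have hF : 0 < Nat.card F := Nat.card_pos
  have c2' : Nat.card {w // l w = 0} ≤ Nat.card F ^ 2 := c2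
  refine Nat.le_of_mul_le_mul_left ?_ hF
  nlinarith

lemma prime_dvd_oddPart {p m : ℕ} (hp : p.Prime) (h2 : p ≠ 2) (h : p ∣ m) : p ∣ oddPart m := by
  have h1 : m = 2 ^ (m.factorization 2) * oddPart m := (Nat.ordProj_mul_ordCompl_eq_self m 2).symm
  rw [h1] at h
  refine (hp.dvd_mul.1 h).resolve_left fun h => h2 ?_
  exact (Nat.prime_dvd_prime_iff_eq hp Nat.prime_two).1 (hp.dvd_of_dvd_pow h)

lemma exists_isotropic_of_sq {F : Type*} [Field F] (b c d : F) (hb : b ≠ 0) (hd0 : d ≠ 0)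
    (hd : -(b * c) = d ^ 2) : ∃ y z : F, b * y ^ 2 + c * z ^ 2 = 0 ∧ b * y ≠ 0 :=
  ⟨d, b, by linear_combination -b * hd, mul_ne_zero hb hd0⟩

lemma exists_sq_of_legendreSym_eq_one {p : ℕ} (hp : p.Prime) {d : ℤ}
    (h : @legendreSym p ⟨hp⟩ d = 1) : ∃ r : ZMod p, (d : ZMod p) = r ^ 2 ∧ r ≠ 0 := by
  have : Fact p.Prime := ⟨hp⟩
  have h0 : (d : ZMod p) ≠ 0 := fun h0 => by
    rw [(legendreSym.eq_zero_iff p d).2 h0] at h; exact zero_ne_one h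
  obtain ⟨r, hr⟩ := (legendreSym.eq_one_iff p h0).1 h
  refine ⟨r, by rw [hr, sq], ?_⟩
  rintro rfl
  exact h0 (by rw [hr, mul_zero])

open Polynomial in
lemma exists_isotropic_diagonal {p : ℕ} [Fact p.Prime] (h2 : p ≠ 2) (α β γ : ZMod p)
    (hα : α ≠ 0) (hβ : β ≠ 0) :
    ∃ x y : ZMod p, α * x ^ 2 + β * y ^ 2 + γ = 0 := by
  have hodd : Fintype.card (ZMod p) % 2 = 1 := by
    rw [ZMod.card]; exact ((Fact.out : p.Prime).eq_two_or_odd).resolve_left h2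
  obtain ⟨x, y, h⟩ := FiniteField.exists_root_sum_quadratic (f := C α * X ^ 2)
    (g := C β * X ^ 2 + C γ) (degree_C_mul_X_pow 2 hα)
    (by compute_degree!) hodd
  refine ⟨x, y, ?_⟩
  simp only [eval_mul, eval_C, eval_pow, eval_X, eval_add] at h
  linear_combination h

lemma exists_isotropic {a b c p : ℕ} [hp : Fact p.Prime] (h2 : p ≠ 2)
    (ha : isQR (-((b : ℤ) * c)) (oddPart a)) (hb : isQR (-(2 * (a : ℤ) * c)) (oddPart b))
    (hc : isQR (-(2 * (a : ℤ) * b)) (oddPart c)) :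
    ∃ e : ZMod p × ZMod p × ZMod p,
      (2 * a : ZMod p) * e.1 ^ 2 + b * e.2.1 ^ 2 + c * e.2.2 ^ 2 = 0 ∧
      ((2 * a : ZMod p) * e.1 ≠ 0 ∨ (b : ZMod p) * e.2.1 ≠ 0 ∨ (c : ZMod p) * e.2.2 ≠ 0) := by
  have hp' : p.Prime := hp.out
  by_cases h0a : (a : ZMod p) = 0
  · obtain ⟨d, hd, hd0⟩ := exists_sq_of_legendreSym_eq_one hp'
      (ha p hp' (prime_dvd_oddPart hp' h2 ((ZMod.natCast_eq_zero_iff _ _).1 h0a)))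
    push_cast at hd
    have hb0 : (b : ZMod p) ≠ 0 := fun h => by
      rw [h, zero_mul, neg_zero] at hd; exact hd0 (pow_eq_zero_iff two_ne_zero |>.1 hd.symm)
    obtain ⟨y, z, h, h'⟩ := exists_isotropic_of_sq _ _ _ hb0 hd0 hd
    exact ⟨(0, y, z), by simpa using h, Or.inr (Or.inl h')⟩
  have h20 : (2 : ZMod p) ≠ 0 := by
    intro h
    have : ((2 : ℕ) : ZMod p) = 0 := by exact_mod_cast h
    exact h2 ((Nat.prime_dvd_prime_iff_eq hp' Nat.prime_two).1
      ((ZMod.natCast_eq_zero_iff _ _).1 this))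
  have h2a : (2 * a : ZMod p) ≠ 0 := mul_ne_zero h20 h0a
  by_cases h0b : (b : ZMod p) = 0
  · obtain ⟨d, hd, hd0⟩ := exists_sq_of_legendreSym_eq_one hp'
      (hb p hp' (prime_dvd_oddPart hp' h2 ((ZMod.natCast_eq_zero_iff _ _).1 h0b)))
    push_cast at hd
    obtain ⟨y, z, h, h'⟩ := exists_isotropic_of_sq _ _ _ h2a hd0 hd
    exact ⟨(y, 0, z), by simpa using h, Or.inl h'⟩
  by_cases h0c : (c : ZMod p) = 0
  · obtain ⟨d, hd, hd0⟩ := exists_sq_of_legendreSym_eq_one hp'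
      (hc p hp' (prime_dvd_oddPart hp' h2 ((ZMod.natCast_eq_zero_iff _ _).1 h0c)))
    push_cast at hd
    obtain ⟨y, z, h, h'⟩ := exists_isotropic_of_sq _ _ _ h2a hd0 hd
    exact ⟨(y, z, 0), by simpa using h, Or.inl h'⟩
  obtain ⟨x, y, h⟩ := exists_isotropic_diagonal h2 (2 * a : ZMod p) b c h2a h0b
  exact ⟨(x, y, 1), by simpa using h, Or.inr (Or.inr (by simpa using h0c))⟩

lemma isUnit_of_castHom_ne_zero {p k : ℕ} [hp : Fact p.Prime] (hk : k ≠ 0)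
    (r : ZMod (p ^ k)) (hr : ZMod.castHom (dvd_pow_self p hk) (ZMod p) r ≠ 0) : IsUnit r := by
  have : NeZero (p ^ k) := ⟨pow_ne_zero _ hp.out.ne_zero⟩
  rw [← ZMod.natCast_zmod_val r] at hr ⊢
  rw [map_natCast, Ne, ZMod.natCast_eq_zero_iff] at hr
  rw [ZMod.isUnit_iff_coprime]
  exact (((Nat.Prime.coprime_iff_not_dvd hp.out).2 hr).symm).pow_right k

/-- The number of solutions of `a x² + b t_y + c t_z = n` to the modulus `V`, doubled. -/
noncomputable def locCount (a b c n V : ℕ) : ℕ :=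
  Nat.card (triSol (2 * a : ZMod V) (b : ZMod V) (c : ZMod V) (2 * n : ZMod V))

/-- The lower bound for the density of solutions at `p`. -/
noncomputable def locFactor (p : ℕ) : ℝ := if p = 2 then 1 else 1 - 1 / p

lemma card_nsTriSol_mul_sq_le (p k : ℕ) [hp : Fact p.Prime] (hk : k ≠ 0) (α β γ ν : ℕ) :
    Nat.card (nsTriSol (α : ZMod p) (β : ZMod p) (γ : ZMod p) (ν : ZMod p)) * (p ^ k) ^ 2 ≤
    Nat.card (triSol (α : ZMod (p ^ k)) (β : ZMod (p ^ k)) (γ : ZMod (p ^ k))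
      (ν : ZMod (p ^ k))) * p ^ 2 := by
  have : NeZero (p ^ k) := ⟨pow_ne_zero _ hp.out.ne_zero⟩
  have := card_nsTriSol_mul_le (ZMod.castHom (dvd_pow_self p hk) (ZMod p))
    (ZMod.castHom_surjective _) (fun r hr => isUnit_of_castHom_ne_zero hk r hr)
    (α : ZMod (p ^ k)) β γ ν
  simpa only [map_natCast, Nat.card_zmod] using this

lemma le_locCount_odd_prime_pow {a b c p k : ℕ} (n : ℕ) (hp : p.Prime) (h2 : p ≠ 2) (hk : k ≠ 0)
    (ha : isQR (-((b : ℤ) * c)) (oddPart a)) (hb : isQR (-(2 * (a : ℤ) * c)) (oddPart b))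
    (hc : isQR (-(2 * (a : ℤ) * b)) (oddPart c)) :
    ((p ^ k : ℕ) : ℝ) ^ 2 * (1 - 1 / p) ≤ locCount a b c n (p ^ k) := by
  have : Fact p.Prime := ⟨hp⟩
  obtain ⟨e, he, hns⟩ := exists_isotropic (p := p) h2 ha hb hc
  have h20 : (2 : ZMod p) ≠ 0 := by
    intro h
    have : ((2 : ℕ) : ZMod p) = 0 := by exact_mod_cast h
    exact h2 ((Nat.prime_dvd_prime_iff_eq hp Nat.prime_two).1
      ((ZMod.natCast_eq_zero_iff _ _).1 this))
  have h1 := card_nsTriSol_ge h20 (2 * a : ZMod p) b c (2 * n) e he hns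
  have h3 := card_nsTriSol_mul_sq_le p k hk (2 * a) b c (2 * n)
  push_cast at h3
  change _ ≤ locCount a b c n (p ^ k) * p ^ 2 at h3
  rw [Nat.card_zmod] at h1
  have hp0 : (0 : ℝ) < p := by exact_mod_cast hp.pos
  have h1' : (p : ℝ) ^ 2 ≤
      Nat.card (nsTriSol (2 * a : ZMod p) (b : ZMod p) (c : ZMod p) (2 * n : ZMod p)) + p := by
    exact_mod_cast h1
  have h3' : (Nat.card (nsTriSol (2 * a : ZMod p) (b : ZMod p) (c : ZMod p) (2 * n : ZMod p)) : ℝ)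
      * ((p ^ k : ℕ) : ℝ) ^ 2 ≤ locCount a b c n (p ^ k) * (p : ℝ) ^ 2 := by
    exact_mod_cast h3
  refine le_of_mul_le_mul_right ?_ (pow_pos hp0 2)
  refine le_trans ?_ h3'
  have : ((p ^ k : ℕ) : ℝ) ^ 2 * (1 - 1 / p) * (p : ℝ) ^ 2 =
      ((p : ℝ) ^ 2 - p) * ((p ^ k : ℕ) : ℝ) ^ 2 := by
    field_simp
  rw [this]
  gcongr
  linarith

lemma le_locCount_two_pow {a b c k : ℕ} (n : ℕ) (hk : k ≠ 0)
    (hgcd : Nat.gcd a (Nat.gcd b c) = 1) (h4 : ¬ 4 ∣ b ∨ ¬ 4 ∣ c) :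
    (2 ^ k) ^ 2 ≤ locCount a b c n (2 ^ k) := by
  have hyy : ∀ y : ZMod 2, y ^ 2 + y = 0 := by decide
  have hy2 : ∀ y : ZMod 2, y ^ 2 = y := by decide
  have : Fact (Nat.Prime 2) := ⟨Nat.prime_two⟩
  have hodd : ∀ {m : ℕ}, m % 2 = 1 → (m : ZMod 2) = 1 := fun {m} h => by
    rw [← Nat.cast_one, ZMod.natCast_eq_natCast_iff]; exact h
  have h20 : (2 : ZMod 2) = 0 := rfl
  by_cases hbc : b % 2 = 1 ∨ c % 2 = 1
  · have h3 := card_nsTriSol_mul_sq_le 2 k hk (2 * a) b c (2 * n)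
    have h5 : Nat.card (nsTriSol ((2 * a : ℕ) : ZMod 2) (b : ZMod 2) (c : ZMod 2)
        ((2 * n : ℕ) : ZMod 2)) = 8 := by
      have : nsTriSol ((2 * a : ℕ) : ZMod 2) (b : ZMod 2) (c : ZMod 2)
        ((2 * n : ℕ) : ZMod 2) = Set.univ := by
        rw [Set.eq_univ_iff_forall]
        rintro ⟨x, y, z⟩
        refine ⟨?_, ?_⟩
        · simp only [triSol, Set.mem_ofPred_eq, hyy]
          push_cast
          rw [h20]; ring
        · simp only [h20, zero_mul, zero_add, mul_one]
          rcases hbc with h | h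
          · exact Or.inr (Or.inl (by rw [hodd h]; exact one_ne_zero))
          · exact Or.inr (Or.inr (by rw [hodd h]; exact one_ne_zero))
      rw [this, Nat.card_univ, Nat.card_prod, Nat.card_prod, Nat.card_zmod]
    rw [h5] at h3
    push_cast at h3
    unfold locCount
    omega
  · have hb : b % 2 = 0 := by omega
    have hc : c % 2 = 0 := by omega
    have ha : a % 2 = 1 := by
      by_contra h
      have h2 : 2 ∣ Nat.gcd a (Nat.gcd b c) :=
        Nat.dvd_gcd (by omega) (Nat.dvd_gcd (by omega) (by omega))
      rw [hgcd] at h2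
      omega
    have h3 := card_nsTriSol_mul_sq_le 2 k hk a (b / 2) (c / 2) n
    have h5 : 4 ≤ Nat.card (nsTriSol (a : ZMod 2) ((b / 2 : ℕ) : ZMod 2) ((c / 2 : ℕ) : ZMod 2)
        (n : ZMod 2)) := by
      have h6 : Nat.card (ZMod 2 × ZMod 2) = 4 := by
        rw [Nat.card_prod, Nat.card_zmod]
      rw [← h6]
      refine Nat.card_le_card_of_injective (fun v => ⟨((n : ZMod 2), v.1, v.2), ?_, ?_⟩) ?_
      · simp only [triSol, Set.mem_ofPred_eq, hyy, hodd ha]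
        rw [hy2]; ring
      · simp only [h20, zero_mul, zero_add, mul_one]
        rcases h4 with h | h
        · exact Or.inr (Or.inl (by rw [hodd (by omega)]; exact one_ne_zero))
        · exact Or.inr (Or.inr (by rw [hodd (by omega)]; exact one_ne_zero))
      · rintro ⟨x, y⟩ ⟨x', y'⟩ h
        have h' := congrArg Subtype.val h
        simpa using h'
    have h6 : Nat.card (triSol (a : ZMod (2 ^ k)) ((b / 2 : ℕ) : ZMod (2 ^ k))
        ((c / 2 : ℕ) : ZMod (2 ^ k)) (n : ZMod (2 ^ k))) ≤ locCount a b c n (2 ^ k) := by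
      have : NeZero (2 ^ k) := ⟨pow_ne_zero _ two_ne_zero⟩
      refine Nat.card_mono (Set.toFinite _) ?_
      rintro ⟨x, y, z⟩ h
      simp only [triSol, Set.mem_ofPred_eq] at h ⊢
      have hb' : (b : ZMod (2 ^ k)) = 2 * ((b / 2 : ℕ) : ZMod (2 ^ k)) := by
        have := congrArg (Nat.cast : ℕ → ZMod (2 ^ k)) (show b = 2 * (b / 2) by omega)
        rwa [Nat.cast_mul, Nat.cast_ofNat] at this
      have hc' : (c : ZMod (2 ^ k)) = 2 * ((c / 2 : ℕ) : ZMod (2 ^ k)) := by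
        have := congrArg (Nat.cast : ℕ → ZMod (2 ^ k)) (show c = 2 * (c / 2) by omega)
        rwa [Nat.cast_mul, Nat.cast_ofNat] at this
      rw [hb', hc']
      linear_combination 2 * h
    have h7 : 4 * (2 ^ k) ^ 2 ≤ locCount a b c n (2 ^ k) * 4 :=
      (Nat.mul_le_mul_right _ h5).trans (h3.trans (by gcongr; norm_num))
    omega

lemma locCount_mul {a b c n V W : ℕ} (h : V.Coprime W) :
    locCount a b c n (V * W) = locCount a b c n V * locCount a b c n W := by
  unfold locCount
  rw [← Nat.card_prod]
  let χ := ZMod.chineseRemainder h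
  have hnat : ∀ m : ℕ, χ (m : ZMod (V * W)) = ((m : ZMod V), (m : ZMod W)) := fun m => by
    rw [map_natCast]; rfl
  have hiff : ∀ x y z : ZMod (V * W), (x, y, z) ∈ triSol (2 * a : ZMod (V * W)) b c (2 * n) ↔
      ((χ x).1, (χ y).1, (χ z).1) ∈ triSol (2 * a : ZMod V) b c (2 * n) ∧
      ((χ x).2, (χ y).2, (χ z).2) ∈ triSol (2 * a : ZMod W) b c (2 * n) := by
    intro x y z
    simp only [triSol, Set.mem_ofPred_eq]
    rw [← χ.injective.eq_iff, Prod.ext_iff]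
    simp only [map_add, map_mul, map_pow, hnat, map_ofNat, Prod.fst_add, Prod.fst_mul,
      Prod.pow_fst, Prod.snd_add, Prod.snd_mul, Prod.pow_snd, Prod.fst_ofNat, Prod.snd_ofNat]
  refine Nat.card_congr
    { toFun := fun v => (⟨((χ v.1.1).1, (χ v.1.2.1).1, (χ v.1.2.2).1), ((hiff _ _ _).1 v.2).1⟩,
        ⟨((χ v.1.1).2, (χ v.1.2.1).2, (χ v.1.2.2).2), ((hiff _ _ _).1 v.2).2⟩)
      invFun := fun v => ⟨(χ.symm (v.1.1.1, v.2.1.1), χ.symm (v.1.1.2.1, v.2.1.2.1),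
        χ.symm (v.1.1.2.2, v.2.1.2.2)), (hiff _ _ _).2 (by
          simp only [RingEquiv.apply_symm_apply]
          exact ⟨v.1.2, v.2.2⟩)⟩
      left_inv := fun v => by simp
      right_inv := fun v => by simp }

lemma locFactor_nonneg (p : ℕ) : 0 ≤ locFactor p := by
  unfold locFactor
  split_ifs
  · exact zero_le_one
  · rcases Nat.eq_zero_or_pos p with rfl | h
    · simp
    · rw [sub_nonneg, div_le_one (by exact_mod_cast h)]
      exact_mod_cast h

lemma le_locCount {a b c : ℕ} (n : ℕ) (hgcd : Nat.gcd a (Nat.gcd b c) = 1)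
    (ha : isQR (-((b : ℤ) * c)) (oddPart a)) (hb : isQR (-(2 * (a : ℤ) * c)) (oddPart b))
    (hc : isQR (-(2 * (a : ℤ) * b)) (oddPart c)) (h4 : ¬ 4 ∣ b ∨ ¬ 4 ∣ c) {V : ℕ} (hV : V ≠ 0) :
    (V : ℝ) ^ 2 * ∏ p ∈ V.primeFactors, locFactor p ≤ locCount a b c n V := by
  induction V using Nat.recOnPosPrimePosCoprime with
  | prime_pow p k hp hk =>
    rw [Nat.primeFactors_prime_pow hk.ne' hp, Finset.prod_singleton, locFactor]
    split_ifs with h2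
    · subst h2
      rw [mul_one]
      exact_mod_cast le_locCount_two_pow n hk.ne' hgcd h4
    · exact le_locCount_odd_prime_pow n hp h2 hk.ne' ha hb hc
  | zero => exact absurd rfl hV
  | one =>
    have : Nonempty (triSol (2 * a : ZMod 1) (b : ZMod 1) (c : ZMod 1) (2 * n : ZMod 1)) :=
      ⟨(0, 0, 0), Subsingleton.elim _ _⟩
    have h1 : 0 < locCount a b c n 1 := Nat.card_pos
    simpa [Nat.one_le_iff_ne_zero, Nat.pos_iff_ne_zero] using h1
  | coprime V W hV1 hW1 hco ihV ihW =>
    rw [locCount_mul hco, hco.primeFactors_mul, Finset.prod_union hco.disjoint_primeFactors]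
    push_cast
    have hP : ∀ V : ℕ, 0 ≤ ∏ p ∈ V.primeFactors, locFactor p :=
      fun V => Finset.prod_nonneg fun p _ => locFactor_nonneg p
    calc _ = ((V : ℝ) ^ 2 * ∏ p ∈ V.primeFactors, locFactor p) *
          ((W : ℝ) ^ 2 * ∏ p ∈ W.primeFactors, locFactor p) := by ring
      _ ≤ _ := mul_le_mul (ihV (by omega)) (ihW (by omega))
          (mul_nonneg (by positivity) (hP W)) (Nat.cast_nonneg _)

/-- The product of the local factors of the primes below `n`. -/
noncomputable def locProd (n : ℕ) : ℝ := ∏ p ∈ Finset.range n with p.Prime, locFactor p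

lemma locProd_succ_of_not_prime {n : ℕ} (h : ¬ n.Prime) : locProd (n + 1) = locProd n := by
  rw [locProd, locProd, Finset.range_add_one, Finset.filter_insert, if_neg h]

lemma locProd_nonneg (n : ℕ) : 0 ≤ locProd n := Finset.prod_nonneg fun p _ => locFactor_nonneg p

lemma le_locProd_succ (n : ℕ) : locProd n * (1 - 1 / n) ≤ locProd (n + 1) := by
  by_cases h : n.Prime
  · rw [locProd, locProd, Finset.range_add_one, Finset.filter_insert, if_pos h,
      Finset.prod_insert (by simp), mul_comm]
    refine mul_le_mul_of_nonneg_right ?_ (locProd_nonneg n)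
    unfold locFactor
    split_ifs
    · rw [sub_le_self_iff]; positivity
    · rfl
  · rw [locProd_succ_of_not_prime h]
    refine mul_le_of_le_one_right (locProd_nonneg n) ?_
    rw [sub_le_self_iff]; positivity

lemma locProd_pos (n : ℕ) : 0 < locProd n := by
  refine Finset.prod_pos fun p hp => ?_
  have h := (Finset.mem_filter.1 hp).2
  unfold locFactor
  split_ifs
  · exact zero_lt_one
  · rw [sub_pos, div_lt_one (by exact_mod_cast h.pos)]
    exact_mod_cast h.one_lt

lemma le_locProd_block (k : ℕ) (hk : 1 ≤ k) :
    locProd (6 * k + 2) * (1 - 1 / (3 * (k + 1))) ≤ locProd (6 * (k + 1) + 2) := by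
  have hn2 : ∀ m, ¬ Nat.Prime (2 * (m + 2)) := fun m =>
    Nat.not_prime_mul (by omega) (by omega)
  have hn3 : ∀ m, ¬ Nat.Prime (3 * (m + 2)) := fun m =>
    Nat.not_prime_mul (by omega) (by omega)
  obtain ⟨j, rfl⟩ : ∃ j, k = j + 1 := ⟨k - 1, by omega⟩
  have e1 : locProd (6 * (j + 1) + 5) = locProd (6 * (j + 1) + 2) := by
    rw [show 6 * (j + 1) + 5 = 2 * (3 * j + 3 + 2) + 1 by ring,
      locProd_succ_of_not_prime (hn2 _),
      show 2 * (3 * j + 3 + 2) = 3 * (2 * j + 1 + 2) + 1 by ring,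
      locProd_succ_of_not_prime (hn3 _),
      show 3 * (2 * j + 1 + 2) = 2 * (3 * j + 2 + 2) + 1 by ring,
      locProd_succ_of_not_prime (hn2 _)]
    congr 1
    ring
  have e2 := le_locProd_succ (6 * (j + 1) + 5)
  have e3 : locProd (6 * (j + 1) + 7) = locProd (6 * (j + 1) + 5 + 1) := by
    rw [show 6 * (j + 1) + 7 = 2 * (3 * j + 4 + 2) + 1 by ring,
      locProd_succ_of_not_prime (hn2 _)]
    congr 1
    ring
  have e4 := le_locProd_succ (6 * (j + 1) + 7)
  rw [show 6 * (j + 1 + 1) + 2 = 6 * (j + 1) + 7 + 1 by ring]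
  refine le_trans ?_ e4
  rw [e3]
  push_cast at e2 ⊢
  have hj : (0 : ℝ) ≤ j := Nat.cast_nonneg j
  have h7 : (0 : ℝ) ≤ 1 - 1 / (6 * (j + 1) + 7) := by
    rw [sub_nonneg, div_le_one (by positivity)]; linarith
  refine le_trans ?_ (mul_le_mul_of_nonneg_right e2 h7)
  rw [e1, mul_assoc]
  refine mul_le_mul_of_nonneg_left ?_ (locProd_nonneg _)
  rw [one_sub_div (by positivity), one_sub_div (by positivity), one_sub_div (by positivity),
    div_mul_div_comm, div_le_div_iff₀ (by positivity) (by positivity)]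
  nlinarith [mul_nonneg hj hj, mul_nonneg (mul_nonneg hj hj) hj]

lemma le_locProd_cube (k : ℕ) (hk : 1 ≤ k) :
    locProd 8 ^ 3 / k ≤ locProd (6 * k + 2) ^ 3 := by
  induction k, hk using Nat.le_induction with
  | base => simp
  | succ k hk ih =>
    have hk0 : (1 : ℝ) ≤ k := by exact_mod_cast hk
    have h1 : (0 : ℝ) ≤ 1 - 1 / (3 * (k + 1)) := by
      rw [sub_nonneg, div_le_one (by positivity)]; linarith
    have h2 := pow_le_pow_left₀ (mul_nonneg (locProd_nonneg _) h1) (le_locProd_block k hk) 3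
    refine le_trans ?_ h2
    rw [mul_pow]
    have h3 : (k : ℝ) / (k + 1) ≤ (1 - 1 / (3 * (k + 1))) ^ 3 := by
      have := one_add_mul_le_pow (a := -(1 / (3 * ((k : ℝ) + 1)))) (by linarith) 3
      refine le_trans (le_of_eq ?_) (this.trans (le_of_eq ?_))
      · push_cast; field_simp; ring
      · ring
    calc locProd 8 ^ 3 / ((k + 1 : ℕ) : ℝ) = locProd 8 ^ 3 / k * (k / (k + 1)) := by
          push_cast; field_simp
      _ ≤ _ := mul_le_mul ih h3 (by positivity) (pow_nonneg (locProd_nonneg _) 3)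

lemma exists_le_locProd_sq_mul (M : ℝ) :
    ∃ P : ℕ, 2 ≤ P ∧ M ≤ locProd (P + 1) ^ 2 * P := by
  have hc : 0 < locProd 8 := locProd_pos 8
  obtain ⟨K, hK⟩ := exists_nat_gt (|M| ^ 3 / (locProd 8 ^ 3) ^ 2)
  have hK0 : (0 : ℝ) < K := lt_of_le_of_lt (by positivity) hK
  have hK1 : 1 ≤ K := by exact_mod_cast hK0
  refine ⟨6 * K + 1, by omega, ?_⟩
  have h1 := le_locProd_cube K hK1
  set D := locProd (6 * K + 2)
  have hD : 0 ≤ D := locProd_nonneg _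
  rw [div_lt_iff₀ (by positivity)] at hK
  rw [div_le_iff₀ hK0] at h1
  by_contra! hlt
  have h2 : D ^ 2 * K ≤ |M| := by
    refine le_trans ?_ (hlt.le.trans (le_abs_self M))
    push_cast
    gcongr
    linarith
  have h3 := pow_le_pow_left₀ (by positivity) h2 3
  have h4 := pow_le_pow_left₀ (by positivity) h1 2
  have : (K : ℝ) * (locProd 8 ^ 3) ^ 2 ≤ (D ^ 2 * K) ^ 3 := by
    calc (K : ℝ) * (locProd 8 ^ 3) ^ 2 ≤ K * (D ^ 3 * K) ^ 2 := by gcongr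
      _ = _ := by ring
  linarith

lemma prod_primeFactors_two_mul_factorial {P : ℕ} (hP : 2 ≤ P) :
    ∏ p ∈ (2 * P.factorial).primeFactors, locFactor p = locProd (P + 1) := by
  unfold locProd
  congr 1
  ext p
  simp only [Nat.mem_primeFactors, Finset.mem_filter, Finset.mem_range]
  constructor
  · rintro ⟨hp, hd, -⟩
    refine ⟨?_, hp⟩
    rcases (hp.dvd_mul).1 hd with h | h
    · have := Nat.le_of_dvd two_pos h
      omega
    · have := (hp.dvd_factorial).1 h
      omega
  · rintro ⟨hlt, hp⟩
    exact ⟨hp, ((hp.dvd_factorial).2 (by omega)).mul_left 2, by positivity⟩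

/-! ### Representations -/

lemma two_mul_triangular (k : ℕ) : 2 * triangular k = k ^ 2 + k := by
  rw [triangular, Nat.mul_div_cancel' (Nat.even_mul_succ_self k).two_dvd]
  ring

/-- The value `a x² + b t_y + c t_z`. -/
def triForm (a b c : ℕ) (v : ℕ × ℕ × ℕ) : ℕ :=
  a * v.1 ^ 2 + b * triangular v.2.1 + c * triangular v.2.2

/-- The triples of natural numbers below `X`. -/
def cube (X : ℕ) : Finset (ℕ × ℕ × ℕ) :=
  Finset.range X ×ˢ Finset.range X ×ˢ Finset.range X

/-- The number of representations of `m` with `x, y, z < X`. -/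
def repCount (a b c X m : ℕ) : ℕ := {v ∈ cube X | triForm a b c v = m}.card

lemma triangular_le_sq {y L : ℕ} (h : y < L) : triangular y ≤ L ^ 2 := by
  have := two_mul_triangular y
  nlinarith

lemma triangular_add (z V : ℕ) : 2 * triangular (z + V) = 2 * triangular z + (2 * z + V + 1) * V := by
  rw [two_mul_triangular, two_mul_triangular]; ring

lemma mul_triangular_step {c V T z : ℕ} (hc : 0 < c) (hV : V ≤ T)
    (h : c * triangular z ≤ 2 * T ^ 2) :
    z ≤ 2 * T ∧ c * triangular (z + V) ≤ c * triangular z + 3 * c * V * T := by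
  have h1 := two_mul_triangular z
  have h2 : triangular z ≤ 2 * T ^ 2 := le_trans (Nat.le_mul_of_pos_left _ hc) h
  have hz : z ≤ 2 * T := by
    by_contra! hlt
    nlinarith
  refine ⟨hz, ?_⟩
  have h3 := triangular_add z V
  rcases Nat.eq_zero_or_pos V with rfl | hV0
  · simp
  have h4 : triangular (z + V) ≤ triangular z + 3 * V * T := by nlinarith
  calc _ ≤ c * (triangular z + 3 * V * T) := by gcongr
    _ = _ := by ring

lemma exists_lt_mul_triangular {c V : ℕ} (hc : 0 < c) (hV : 0 < V) (z₀ m : ℕ) :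
    ∃ j, m < c * triangular (z₀ + V * j) := by
  refine ⟨m + 1, lt_of_lt_of_le ?_ (Nat.le_mul_of_pos_left _ hc)⟩
  have h1 := two_mul_triangular (z₀ + V * (m + 1))
  have h2 : m + 1 ≤ z₀ + V * (m + 1) := le_add_left (Nat.le_mul_of_pos_left _ hV)
  nlinarith

/-- The first index at which the progression `c t_{z₀ + V j}` exceeds `m`. -/
def firstIndex {c V : ℕ} (hc : 0 < c) (hV : 0 < V) (z₀ m : ℕ) : ℕ :=
  Nat.find (exists_lt_mul_triangular hc hV z₀ m)

lemma firstIndex_bounds {c V T z₀ m B : ℕ} (hc : 0 < c) (hV : 0 < V) (hz₀ : z₀ < V) (hVT : V ≤ T)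
    (hm : m < T ^ 2) (hB : B ≤ T ^ 2) (i : ℕ) (hi : i < B / (3 * c * V * T)) :
    m < c * triangular (z₀ + V * (firstIndex hc hV z₀ m + i)) ∧
    c * triangular (z₀ + V * (firstIndex hc hV z₀ m + i)) ≤ m + B ∧
    z₀ + V * (firstIndex hc hV z₀ m + i) < 3 * T := by
  set j₀ := firstIndex hc hV z₀ m with hj₀
  have hT : 0 < T := by omega
  have hspec : m < c * triangular (z₀ + V * j₀) := Nat.find_spec (exists_lt_mul_triangular hc hV z₀ m)
  have hmono : triangular (z₀ + V * j₀) ≤ triangular (z₀ + V * (j₀ + i)) := by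
    have h1 := two_mul_triangular (z₀ + V * j₀)
    have h2 := two_mul_triangular (z₀ + V * (j₀ + i))
    have h3 : z₀ + V * j₀ ≤ z₀ + V * (j₀ + i) := by gcongr; omega
    have h4 := Nat.pow_le_pow_left h3 2
    omega
  have hΔ : 0 < 3 * c * V * T := by positivity
  have hup : ∀ i, i < B / (3 * c * V * T) →
      c * triangular (z₀ + V * (j₀ + i)) ≤ m + (i + 1) * (3 * c * V * T) := by
    intro i
    induction i with
    | zero =>
      intro hi
      rcases Nat.eq_zero_or_pos j₀ with h0 | h0
      · rw [h0]
        have h1 := triangular_le_sq hz₀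
        have h2 : c * triangular z₀ ≤ c * (V * T) := by gcongr; nlinarith
        simp only [add_zero, mul_zero]
        nlinarith
      · have hlt : ¬ m < c * triangular (z₀ + V * (j₀ - 1)) :=
          Nat.find_min (exists_lt_mul_triangular hc hV z₀ m) (by
            change j₀ - 1 < j₀; omega)
        have h1 := (mul_triangular_step (z := z₀ + V * (j₀ - 1)) hc hVT (by omega)).2
        have h2 : z₀ + V * (j₀ - 1) + V = z₀ + V * (j₀ + 0) := by
          obtain ⟨k, hk⟩ : ∃ k, j₀ = k + 1 := ⟨j₀ - 1, by omega⟩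
          rw [hk]; simp; ring
        rw [h2] at h1
        omega
    | succ i ih =>
      intro hi
      have h0 := ih (by omega)
      have h3 : (i + 1) * (3 * c * V * T) ≤ B :=
        (Nat.le_div_iff_mul_le hΔ).1 (by omega)
      have h1 := (mul_triangular_step (z := z₀ + V * (j₀ + i)) hc hVT (by omega)).2
      have h2 : z₀ + V * (j₀ + i) + V = z₀ + V * (j₀ + (i + 1)) := by ring
      rw [h2] at h1
      have : (i + 1 + 1) * (3 * c * V * T) = (i + 1) * (3 * c * V * T) + 3 * c * V * T := by ring
      omega
  have h3 : (i + 1) * (3 * c * V * T) ≤ B := (Nat.le_div_iff_mul_le hΔ).1 (by omega)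
  have h4 := hup i hi
  have h5 := (mul_triangular_step (z := z₀ + V * (j₀ + i)) hc hVT (by omega)).1
  exact ⟨hspec.trans_le (Nat.mul_le_mul_left c hmono), by omega, by omega⟩

lemma add_mul_lt_of_lt_div {x V i L : ℕ} (hx : x < V) (hi : i < L / V) : x + V * i < L := by
  have h1 : (i + 1) * V ≤ L := (Nat.le_div_iff_mul_le (by omega)).1 hi
  nlinarith

lemma add_mul_val_inj {V : ℕ} [NeZero V] {x y : ZMod V} {i j : ℕ}
    (h : x.val + V * i = y.val + V * j) : x = y ∧ i = j := by
  have hx := ZMod.val_lt x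
  have hy := ZMod.val_lt y
  have hV : 0 < V := by omega
  have h1 := congrArg (· % V) h
  simp only [Nat.add_mul_mod_self_left, Nat.mod_eq_of_lt hx, Nat.mod_eq_of_lt hy] at h1
  refine ⟨ZMod.val_injective V h1, ?_⟩
  rw [h1] at h
  exact Nat.eq_of_mul_eq_mul_left hV (by omega)

lemma triForm_modEq {a b c n W : ℕ} {v : ZMod (2 * W) × ZMod (2 * W) × ZMod (2 * W)}
    (hv : v ∈ triSol (2 * a : ZMod (2 * W)) (b : ZMod (2 * W)) (c : ZMod (2 * W)) (2 * n))
    {x y z : ℕ} (hx : (x : ZMod (2 * W)) = v.1) (hy : (y : ZMod (2 * W)) = v.2.1)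
    (hz : (z : ZMod (2 * W)) = v.2.2) : triForm a b c (x, y, z) ≡ n [MOD W] := by
  have h1 : 2 * triForm a b c (x, y, z) = 2 * a * x ^ 2 + b * (y ^ 2 + y) + c * (z ^ 2 + z) := by
    rw [triForm, ← two_mul_triangular, ← two_mul_triangular]; ring
  have h2 : ((2 * triForm a b c (x, y, z) : ℕ) : ZMod (2 * W)) = ((2 * n : ℕ) : ZMod (2 * W)) := by
    rw [h1]
    push_cast
    rw [hx, hy, hz]
    exact hv
  exact Nat.ModEq.mul_left_cancel' two_ne_zero ((ZMod.natCast_eq_natCast_iff _ _ _).1 h2)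

lemma locCount_mul_le_sum_repCount {a b c W T L K n : ℕ} (hc : 0 < c) (hW : 0 < W)
    (hVT : 2 * W ≤ T) (hn : n < T ^ 2) (hLn : (a + b) * L ^ 2 ≤ n) (hLT : L ≤ T)
    (hK : K * W ≤ T ^ 2) :
    locCount a b c n (2 * W) * (L / (2 * W)) ^ 2 * (K * W / (3 * c * (2 * W) * T)) ≤
      ∑ j ∈ Finset.Icc 1 K, repCount a b c (3 * T) (n + j * W) := by
  classical
  have hV : 0 < 2 * W := by omega
  have : NeZero (2 * W) := ⟨hV.ne'⟩
  set V := 2 * W with hVW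
  let S : Finset (ℕ × ℕ × ℕ) := (Finset.Icc 1 K).biUnion fun j =>
    {v ∈ cube (3 * T) | triForm a b c v = n + j * W}
  have hS : S.card ≤ ∑ j ∈ Finset.Icc 1 K, repCount a b c (3 * T) (n + j * W) :=
    Finset.card_biUnion_le
  refine le_trans ?_ hS
  let D := triSol (2 * a : ZMod V) (b : ZMod V) (c : ZMod V) (2 * n) ×
    (Fin (L / V) × Fin (L / V)) × Fin (K * W / (3 * c * V * T))
  let px : D → ℕ := fun d => d.1.1.1.val + V * d.2.1.1
  let py : D → ℕ := fun d => d.1.1.2.1.val + V * d.2.1.2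
  let pm : D → ℕ := fun d => n - (a * px d ^ 2 + b * triangular (py d))
  let pz : D → ℕ := fun d =>
    d.1.1.2.2.val + V * (firstIndex hc hV d.1.1.2.2.val (pm d) + d.2.2)
  have hmem : ∀ d : D, (px d, py d, pz d) ∈ S := by
    intro d
    have hx : px d < L := add_mul_lt_of_lt_div (ZMod.val_lt _) d.2.1.1.2
    have hy : py d < L := add_mul_lt_of_lt_div (ZMod.val_lt _) d.2.1.2.2
    have hle : a * px d ^ 2 + b * triangular (py d) ≤ n := by
      refine le_trans ?_ hLn
      rw [add_mul]
      have := triangular_le_sq hy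
      gcongr
    obtain ⟨h1, h2, h3⟩ := firstIndex_bounds (T := T) (B := K * W) (m := pm d) hc hV
      (ZMod.val_lt d.1.1.2.2) hVT (lt_of_le_of_lt (Nat.sub_le _ _) hn) hK d.2.2 d.2.2.2
    change pm d < c * triangular (pz d) at h1
    change c * triangular (pz d) ≤ pm d + K * W at h2
    change pz d < 3 * T at h3
    have hpm : pm d + (a * px d ^ 2 + b * triangular (py d)) = n := Nat.sub_add_cancel hle
    have hmod : triForm a b c (px d, py d, pz d) ≡ n [MOD W] :=
      triForm_modEq d.1.2 (by simp [px]) (by simp [py]) (by simp [pz])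
    have hval : triForm a b c (px d, py d, pz d) =
        a * px d ^ 2 + b * triangular (py d) + c * triangular (pz d) := rfl
    obtain ⟨j, hj⟩ := (Nat.modEq_iff_dvd' (by omega)).1 hmod.symm
    have hj' : triForm a b c (px d, py d, pz d) = n + j * W := by
      rw [mul_comm j W, ← hj]; omega
    refine Finset.mem_biUnion.2 ⟨j, Finset.mem_Icc.2 ⟨?_, ?_⟩, Finset.mem_filter.2 ⟨?_, hj'⟩⟩
    · rcases Nat.eq_zero_or_pos j with rfl | h
      · omega
      · exact h
    · exact Nat.le_of_mul_le_mul_right (by omega : j * W ≤ K * W) hW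
    · simp only [cube, Finset.mem_product, Finset.mem_range]
      omega
  have hinj : Function.Injective fun d : D => (⟨(px d, py d, pz d), hmem d⟩ : S) := by
    intro d d' h
    simp only [Subtype.mk.injEq, Prod.mk.injEq] at h
    obtain ⟨h1, h2, h3⟩ := h
    have hm : pm d = pm d' := by simp only [pm, h1, h2]
    obtain ⟨e1, f1⟩ := add_mul_val_inj h1
    obtain ⟨e2, f2⟩ := add_mul_val_inj h2
    obtain ⟨e3, f3⟩ := add_mul_val_inj h3
    rw [hm, e3] at f3
    obtain ⟨⟨⟨x, y, z⟩, hv⟩, ⟨i, j⟩, k⟩ := d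
    obtain ⟨⟨⟨x', y', z'⟩, hv'⟩, ⟨i', j'⟩, k'⟩ := d'
    have f3' := Nat.add_left_cancel f3
    exact Prod.ext (Subtype.ext (Prod.ext e1 (Prod.ext e2 e3)))
      (Prod.ext (Prod.ext (Fin.ext f1) (Fin.ext f2)) (Fin.ext f3'))
  have hcard := Nat.card_le_card_of_injective _ hinj
  rw [Nat.card_eq_fintype_card (α := S), Fintype.card_coe] at hcard
  refine le_trans (le_of_eq ?_) hcard
  simp only [D, Nat.card_prod, Nat.card_eq_fintype_card (α := Fin _), Fintype.card_fin]
  unfold locCount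
  ring

/-! ### Necessity: local obstructions -/

lemma not_asympUniversal_of_forall_not_modEq {sol : ℕ → Prop} {q r : ℕ} (hq : 0 < q)
    (h : ∀ n, sol n → ¬ n ≡ r [MOD q]) : ¬ AsympUniversal sol := by
  intro hu
  have ht : Filter.Tendsto (fun M : ℕ => q * M) Filter.atTop Filter.atTop :=
    Filter.tendsto_id.const_mul_atTop' hq
  have h0 := hu.comp ht
  have hge : (1 : ℝ) / q ≤ 0 := by
    refine ge_of_tendsto h0 ?_
    filter_upwards [Filter.eventually_ge_atTop 1] with M hM
    have hcard : M ≤ {n : ℕ | n < q * M ∧ ¬ sol n}.ncard := by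
      have hfin : {n : ℕ | n < q * M ∧ ¬ sol n}.Finite :=
        (Set.finite_lt_nat (q * M)).subset fun n hn => hn.1
      have hsub : (((Finset.range M).image fun k => q * k + r % q : Finset ℕ) : Set ℕ) ⊆
          {n : ℕ | n < q * M ∧ ¬ sol n} := by
        intro n hn
        obtain ⟨k, hk, rfl⟩ := Finset.mem_image.1 (Finset.mem_coe.1 hn)
        rw [Finset.mem_range] at hk
        refine ⟨?_, fun hs => h _ hs ?_⟩
        · have := Nat.mod_lt r hq
          nlinarith
        · simp [Nat.ModEq]
      have hinj : Function.Injective fun k => q * k + r % q := fun i j hij =>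
        Nat.eq_of_mul_eq_mul_left hq (Nat.add_right_cancel hij)
      calc M = ((Finset.range M).image fun k => q * k + r % q : Finset ℕ).card := by
            rw [Finset.card_image_of_injective _ hinj, Finset.card_range]
        _ = (((Finset.range M).image fun k => q * k + r % q : Finset ℕ) : Set ℕ).ncard := by
            rw [Set.ncard_coe_finset]
        _ ≤ _ := Set.ncard_le_ncard hsub hfin
    have hq' : (0 : ℝ) < q := by exact_mod_cast hq
    have hM' : (0 : ℝ) < M := by exact_mod_cast hM
    have hcard' : (M : ℝ) ≤ {n : ℕ | n < q * M ∧ ¬ sol n}.ncard := by exact_mod_cast hcard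
    simp only [Function.comp_apply, Nat.cast_mul]
    rw [div_le_div_iff₀ hq' (by positivity)]
    nlinarith
  have : (0 : ℝ) < 1 / q := by positivity
  linarith

lemma exists_forall_mul_sq_ne {p : ℕ} [Fact p.Prime] (hp2 : p ≠ 2) (C : ZMod p) :
    ∃ u : ZMod p, ∀ z : ZMod p, C * z ^ 2 ≠ u := by
  by_contra! hcon
  have hsurj : Function.Surjective fun z : ZMod p => C * z ^ 2 := hcon
  have hinj := Finite.injective_iff_surjective.2 hsurj
  have h1 : (1 : ZMod p) = -1 := hinj (by simp)
  have : Fact (2 < p) := ⟨lt_of_le_of_ne (Fact.out : p.Prime).two_le hp2.symm⟩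
  exact ZMod.neg_one_ne_one h1.symm

lemma exists_forall_diagonal_ne {p : ℕ} [Fact p.Prime] (hp2 : p ≠ 2) {A B C : ℤ}
    (hA : (p : ℤ) ∣ A) (hBC : legendreSym p (-(B * C)) ≠ 1) :
    ∃ m : ℤ, ∀ X Y Z : ℤ, ¬ A * X ^ 2 + B * Y ^ 2 + C * Z ^ 2 ≡ m [ZMOD (p ^ 2 : ℕ)] := by
  have hp0 : (p : ℤ) ≠ 0 := by exact_mod_cast (Fact.out : p.Prime).ne_zero
  have hpp : ((p : ℕ) : ℤ) ∣ ((p ^ 2 : ℕ) : ℤ) := by exact_mod_cast dvd_pow_self p two_ne_zero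
  have hA0 : (A : ZMod p) = 0 := (ZMod.intCast_zmod_eq_zero_iff_dvd A p).2 hA
  have key : ∀ {m X Y Z : ℤ}, A * X ^ 2 + B * Y ^ 2 + C * Z ^ 2 ≡ m [ZMOD (p ^ 2 : ℕ)] →
      (B : ZMod p) * Y ^ 2 + C * Z ^ 2 = m := by
    intro m X Y Z h
    have h1 := (ZMod.intCast_eq_intCast_iff _ _ p).2 (h.of_dvd hpp)
    push_cast at h1
    rw [← h1, hA0]; ring
  by_cases hB : (B : ZMod p) = 0
  · obtain ⟨u, hu⟩ := exists_forall_mul_sq_ne hp2 (C : ZMod p)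
    refine ⟨u.val, fun X Y Z h => hu Z ?_⟩
    simpa [hB] using key h
  by_cases hC : (C : ZMod p) = 0
  · obtain ⟨u, hu⟩ := exists_forall_mul_sq_ne hp2 (B : ZMod p)
    refine ⟨u.val, fun X Y Z h => hu Y ?_⟩
    simpa [hC] using key h
  have haniso : ∀ y z : ZMod p, (B : ZMod p) * y ^ 2 + C * z ^ 2 = 0 → y = 0 ∧ z = 0 := by
    intro y z h
    have hz : z = 0 := by
      by_contra hz
      have hne : ((-(B * C) : ℤ) : ZMod p) ≠ 0 := by
        push_cast
        exact neg_ne_zero.2 (mul_ne_zero hB hC)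
      refine hBC ((legendreSym.eq_one_iff p hne).2 ⟨B * y / z, ?_⟩)
      push_cast
      field_simp
      linear_combination -h
    subst hz
    simpa [hB] using h
  obtain ⟨A', rfl⟩ := hA
  obtain ⟨u, hu⟩ := exists_forall_mul_sq_ne hp2 (A' : ZMod p)
  refine ⟨p * u.val, fun X Y Z h => hu X ?_⟩
  obtain ⟨hY, hZ⟩ := haniso Y Z (by simpa using key h)
  obtain ⟨Y', rfl⟩ := (ZMod.intCast_zmod_eq_zero_iff_dvd Y p).1 hY
  obtain ⟨Z', rfl⟩ := (ZMod.intCast_zmod_eq_zero_iff_dvd Z p).1 hZ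
  obtain ⟨k, hk⟩ := h.dvd
  have h2 : (u.val : ℤ) - A' * X ^ 2 = p * (B * Y' ^ 2 + C * Z' ^ 2 + k) := by
    refine mul_left_cancel₀ hp0 ?_
    push_cast at hk
    linear_combination hk
  have h3 := congrArg (Int.cast : ℤ → ZMod p) h2
  push_cast at h3
  simp only [CharP.cast_eq_zero, zero_mul, ZMod.natCast_val, ZMod.cast_id', id] at h3
  exact (sub_eq_zero.1 h3).symm

lemma not_asympUniversal_of_legendreSym_ne_one {a b c p : ℕ} [Fact p.Prime] (hp2 : p ≠ 2)
    {A B C : ℤ} (hA : (p : ℤ) ∣ A) (hBC : legendreSym p (-(B * C)) ≠ 1)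
    (hform : ∀ x y z : ℤ, ∃ X Y Z : ℤ,
      8 * a * x ^ 2 + b * (2 * y + 1) ^ 2 + c * (2 * z + 1) ^ 2 =
        A * X ^ 2 + B * Y ^ 2 + C * Z ^ 2) :
    ¬ AsympUniversal (fun n => ∃ x y z : ℕ,
        a * x ^ 2 + b * triangular y + c * triangular z = n) := by
  obtain ⟨m, hm⟩ := exists_forall_diagonal_ne hp2 hA hBC
  have hp : p.Prime := Fact.out
  have : NeZero (p ^ 2) := ⟨pow_ne_zero 2 hp.ne_zero⟩
  have hcop : Nat.Coprime 8 (p ^ 2) :=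
    Nat.Coprime.pow 3 2 ((Nat.coprime_primes Nat.prime_two hp).2 hp2.symm)
  have h8 : (8 : ZMod (p ^ 2)) * (8 : ZMod (p ^ 2))⁻¹ = 1 := by
    simpa using ZMod.coe_mul_inv_eq_one 8 hcop
  refine not_asympUniversal_of_forall_not_modEq (q := p ^ 2)
    (r := ((8 : ZMod (p ^ 2))⁻¹ * (m - b - c)).val) (NeZero.pos _) ?_
  rintro _ ⟨x, y, z, rfl⟩ h
  obtain ⟨X, Y, Z, hXYZ⟩ := hform x y z
  refine hm X Y Z ?_
  rw [← hXYZ, ← ZMod.intCast_eq_intCast_iff]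
  have h1 := (ZMod.natCast_eq_natCast_iff _ _ _).2 h
  rw [ZMod.natCast_val, ZMod.cast_id', id] at h1
  have hy := congrArg (Nat.cast : ℕ → ZMod (p ^ 2)) (two_mul_triangular y)
  have hz := congrArg (Nat.cast : ℕ → ZMod (p ^ 2)) (two_mul_triangular z)
  push_cast at h1 hy hz ⊢
  linear_combination 8 * h1 + (m - b - c : ZMod (p ^ 2)) * h8 - 4 * b * hy - 4 * c * hz

lemma prime_dvd_of_dvd_oddPart {p m : ℕ} (hp : p.Prime) (hm : 0 < m) (h : p ∣ oddPart m) :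
    p ≠ 2 ∧ p ∣ m := by
  refine ⟨?_, h.trans (Nat.ordCompl_dvd m 2)⟩
  rintro rfl
  exact Nat.not_dvd_ordCompl Nat.prime_two hm.ne' h

lemma not_asympUniversal_of_four_dvd {a b c : ℕ} (hgcd : Nat.gcd a (Nat.gcd b c) = 1)
    (hb : 4 ∣ b) (hc : 4 ∣ c) :
    ¬ AsympUniversal (fun n => ∃ x y z : ℕ,
        a * x ^ 2 + b * triangular y + c * triangular z = n) := by
  have ha : a % 2 = 1 := by
    by_contra hodd
    have h2 : 2 ∣ Nat.gcd a (Nat.gcd b c) :=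
      Nat.dvd_gcd (by omega) (Nat.dvd_gcd (by omega) (by omega))
    omega
  refine not_asympUniversal_of_forall_not_modEq (q := 4) (r := 2) (by norm_num) ?_
  rintro _ ⟨x, y, z, rfl⟩ h
  obtain ⟨b', rfl⟩ := hb
  obtain ⟨c', rfl⟩ := hc
  have h1 : (a * x ^ 2) % 4 = 2 := by
    unfold Nat.ModEq at h
    rw [mul_assoc, mul_assoc] at h
    omega
  rcases Nat.even_or_odd' x with ⟨k, rfl | rfl⟩
  · have : a * (2 * k) ^ 2 = 4 * (a * k ^ 2) := by ring
    omega
  · have : a * (2 * k + 1) ^ 2 = 4 * (a * (k ^ 2 + k)) + a := by ring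
    omega

theorem local_conditions_of_asympUniversal {a b c : ℕ}
    (ha : 0 < a) (hb : 0 < b) (hc : 0 < c) (hgcd : Nat.gcd a (Nat.gcd b c) = 1)
    (h : AsympUniversal (fun n => ∃ x y z : ℕ,
        a * x ^ 2 + b * triangular y + c * triangular z = n)) :
    (isQR (-((b : ℤ) * c)) (oddPart a) ∧ isQR (-(2 * (a : ℤ) * c)) (oddPart b) ∧
      isQR (-(2 * (a : ℤ) * b)) (oddPart c)) ∧ (¬ (4 ∣ b) ∨ ¬ (4 ∣ c)) := by
  refine ⟨⟨?_, ?_, ?_⟩, ?_⟩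
  · intro p hp hpd
    have : Fact p.Prime := ⟨hp⟩
    obtain ⟨hp2, hdvd⟩ := prime_dvd_of_dvd_oddPart hp ha hpd
    by_contra hne
    refine not_asympUniversal_of_legendreSym_ne_one hp2 (A := 8 * a) (B := b) (C := c)
      ((Int.natCast_dvd_natCast.2 hdvd).mul_left 8) hne (fun x y z => ⟨x, 2 * y + 1, 2 * z + 1, rfl⟩) h
  · intro p hp hpd
    have : Fact p.Prime := ⟨hp⟩
    obtain ⟨hp2, hdvd⟩ := prime_dvd_of_dvd_oddPart hp hb hpd
    by_contra hne
    refine not_asympUniversal_of_legendreSym_ne_one hp2 (A := b) (B := 2 * a) (C := c)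
      (Int.natCast_dvd_natCast.2 hdvd) hne
      (fun x y z => ⟨2 * y + 1, 2 * x, 2 * z + 1, by ring⟩) h
  · intro p hp hpd
    have : Fact p.Prime := ⟨hp⟩
    obtain ⟨hp2, hdvd⟩ := prime_dvd_of_dvd_oddPart hp hc hpd
    by_contra hne
    refine not_asympUniversal_of_legendreSym_ne_one hp2 (A := c) (B := 2 * a) (C := b)
      (Int.natCast_dvd_natCast.2 hdvd) hne
      (fun x y z => ⟨2 * z + 1, 2 * x, 2 * y + 1, by ring⟩) h
  · by_contra! h4
    exact not_asympUniversal_of_four_dvd hgcd h4.1 h4.2 h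

/-! ### Exponential sums -/

/-- The additive character `t ↦ exp (2πit)`. -/
noncomputable def expi (t : ℝ) : ℂ := Complex.exp (Complex.I * (2 * Real.pi * t : ℝ))

/-- The distance to the nearest integer. -/
noncomputable def distInt (x : ℝ) : ℝ := |x - round x|

lemma expi_add (s t : ℝ) : expi (s + t) = expi s * expi t := by
  rw [expi, expi, expi, ← Complex.exp_add, ← mul_add, ← Complex.ofReal_add, mul_add]

lemma expi_zero : expi 0 = 1 := by simp [expi]

lemma norm_expi (t : ℝ) : ‖expi t‖ = 1 := by
  rw [expi, mul_comm, Complex.norm_exp_ofReal_mul_I]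

lemma conj_expi (t : ℝ) : (starRingEnd ℂ) (expi t) = expi (-t) := by
  rw [expi, expi, ← Complex.exp_conj, map_mul, Complex.conj_I, Complex.conj_ofReal]
  congr 1
  push_cast
  ring

lemma expi_intCast (k : ℤ) : expi k = 1 := by
  rw [expi, Complex.exp_eq_one_iff]
  exact ⟨k, by push_cast; ring⟩

lemma expi_natCast_mul (n : ℕ) (t : ℝ) : expi (n * t) = expi t ^ n := by
  rw [expi, expi, ← Complex.exp_nat_mul]
  congr 1
  push_cast
  ring

lemma expi_add_intCast (t : ℝ) (k : ℤ) : expi (t + k) = expi t := by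
  rw [expi_add, expi_intCast, mul_one]

@[fun_prop]
lemma continuous_expi : Continuous expi := by
  unfold expi
  fun_prop

lemma norm_expi_sub_one_le_two (t : ℝ) : ‖expi t - 1‖ ≤ 2 := by
  have := norm_sub_le (expi t) 1
  rw [norm_expi, norm_one] at this
  linarith

lemma norm_expi_sub_one_le (t : ℝ) : ‖expi t - 1‖ ≤ 2 * Real.pi * |t| := by
  refine (Real.norm_exp_I_mul_ofReal_sub_one_le).trans ?_
  rw [Real.norm_eq_abs, abs_mul, abs_of_pos Real.two_pi_pos]

lemma four_mul_distInt_le (t : ℝ) : 4 * distInt t ≤ ‖expi t - 1‖ := by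
  have h0 : expi t = expi (t - round t) := by
    conv_lhs => rw [← sub_add_cancel t (round t : ℝ)]
    exact expi_add_intCast _ _
  have h1 := abs_sub_round t
  rw [h0, expi, Complex.norm_exp_I_mul_ofReal_sub_one, distInt, Real.norm_eq_abs, abs_mul, abs_two]
  have hpi := Real.pi_pos
  have habs : |2 * Real.pi * (t - round t) / 2| = Real.pi * |t - round t| := by
    rw [show 2 * Real.pi * (t - round t) / 2 = Real.pi * (t - round t) by ring, abs_mul,
      abs_of_pos hpi]
  have h2 := Real.mul_abs_le_abs_sin (x := 2 * Real.pi * (t - round t) / 2)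
    (by rw [habs]; nlinarith)
  rw [habs] at h2
  have h3 : 2 / Real.pi * (Real.pi * |t - round t|) = 2 * |t - round t| := by field_simp
  linarith

lemma norm_sum_expi_mul_le {n X : ℕ} (hn : n ≤ X) (θ : ℝ) :
    ‖∑ x ∈ Finset.range n, expi (x * θ)‖ ≤ 2 * (X / (1 + X * distInt θ)) := by
  have hd : 0 ≤ distInt θ := abs_nonneg _
  have hn' : (n : ℝ) ≤ X := by exact_mod_cast hn
  have hX : (0 : ℝ) ≤ X := Nat.cast_nonneg X
  have htriv : ‖∑ x ∈ Finset.range n, expi (x * θ)‖ ≤ n := by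
    refine (norm_sum_le _ _).trans ?_
    simp [norm_expi]
  rw [← mul_div_assoc, le_div_iff₀ (by positivity)]
  rcases le_total (X * distInt θ) 1 with h | h
  · have := norm_nonneg (∑ x ∈ Finset.range n, expi (x * θ))
    nlinarith
  · have hgeom : ‖∑ x ∈ Finset.range n, expi (x * θ)‖ * ‖expi θ - 1‖ ≤ 2 := by
      rw [← norm_mul]
      simp_rw [expi_natCast_mul]
      rw [geom_sum_mul, ← expi_natCast_mul]
      exact norm_expi_sub_one_le_two _
    have h4 := four_mul_distInt_le θ
    have hS := norm_nonneg (∑ x ∈ Finset.range n, expi (x * θ))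
    have h5 : ‖∑ x ∈ Finset.range n, expi (x * θ)‖ * (4 * distInt θ) ≤ 2 :=
      (mul_le_mul_of_nonneg_left h4 hS).trans hgeom
    have h6 : ‖∑ x ∈ Finset.range n, expi (x * θ)‖ * (1 + X * distInt θ) ≤
        ‖∑ x ∈ Finset.range n, expi (x * θ)‖ * (2 * (X * distInt θ)) := by
      gcongr; linarith
    nlinarith

lemma normSq_sum_range (u : ℕ → ℂ) (X : ℕ) :
    ‖∑ x ∈ Finset.range X, u x‖ ^ 2 = ∑ x ∈ Finset.range X, ‖u x‖ ^ 2 +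
      2 * (∑ h ∈ Finset.range X, ∑ x ∈ Finset.range (X - (h + 1)),
        u (x + (h + 1)) * (starRingEnd ℂ) (u x)).re := by
  induction X with
  | zero => simp
  | succ X ih =>
    have hstep : ∑ h ∈ Finset.range (X + 1), ∑ x ∈ Finset.range (X + 1 - (h + 1)),
        u (x + (h + 1)) * (starRingEnd ℂ) (u x) =
        ∑ h ∈ Finset.range X, ∑ x ∈ Finset.range (X - (h + 1)),
          u (x + (h + 1)) * (starRingEnd ℂ) (u x) +
        u X * (starRingEnd ℂ) (∑ x ∈ Finset.range X, u x) := by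
      rw [Finset.sum_range_succ, Nat.sub_self, Finset.range_zero, Finset.sum_empty, add_zero,
        map_sum, Finset.mul_sum,
        ← Finset.sum_range_reflect (fun x => u X * (starRingEnd ℂ) (u x)) X,
        ← Finset.sum_add_distrib]
      refine Finset.sum_congr rfl fun h hh => ?_
      rw [Finset.mem_range] at hh
      obtain ⟨k, rfl⟩ : ∃ k, X = k + (h + 1) := ⟨X - (h + 1), by omega⟩
      rw [show k + (h + 1) + 1 - (h + 1) = k + 1 by omega, Finset.sum_range_succ,
        show k + (h + 1) - (h + 1) = k by omega, show k + (h + 1) - 1 - h = k by omega]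
    rw [hstep, Finset.sum_range_succ, Finset.sum_range_succ, Complex.add_re, mul_add, ← add_assoc,
      add_right_comm _ (‖u X‖ ^ 2), ← ih, ← Complex.normSq_eq_norm_sq, ← Complex.normSq_eq_norm_sq,
      ← Complex.normSq_eq_norm_sq, Complex.normSq_add, mul_comm (u X), ← Complex.conj_re,
      map_mul, Complex.conj_conj]

/-- The Weyl majorant. -/
noncomputable def weylSum (X H : ℕ) (α : ℝ) : ℝ :=
  ∑ h ∈ Finset.Icc 1 H, (X : ℝ) / (1 + X * distInt (h * α))

lemma weylSum_nonneg (X H : ℕ) (α : ℝ) : 0 ≤ weylSum X H α :=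
  Finset.sum_nonneg fun h _ => by
    have : 0 ≤ distInt (h * α) := abs_nonneg _
    positivity

lemma normSq_quadratic_sum_le {φ ψ : ℕ → ℕ} {d X H : ℕ} (hd : 0 < d) (hH : d * X ≤ H)
    (hφ : ∀ x h, φ (x + h) = φ x + d * h * x + ψ h) (α : ℝ) :
    ‖∑ x ∈ Finset.range X, expi (φ x * α)‖ ^ 2 ≤ X + 4 * weylSum X H α := by
  rw [normSq_sum_range]
  simp only [norm_expi, one_pow, Finset.sum_const, Finset.card_range, nsmul_eq_mul, mul_one]
  have hinner : ∀ h, ‖∑ x ∈ Finset.range (X - (h + 1)),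
      expi (φ (x + (h + 1)) * α) * (starRingEnd ℂ) (expi (φ x * α))‖ ≤
      2 * (X / (1 + X * distInt ((d * (h + 1) : ℕ) * α))) := by
    intro h
    have heq : ∑ x ∈ Finset.range (X - (h + 1)),
        expi (φ (x + (h + 1)) * α) * (starRingEnd ℂ) (expi (φ x * α)) =
        expi (ψ (h + 1) * α) *
          ∑ x ∈ Finset.range (X - (h + 1)), expi (x * ((d * (h + 1) : ℕ) * α)) := by
      rw [Finset.mul_sum]
      refine Finset.sum_congr rfl fun x _ => ?_
      rw [conj_expi, ← expi_add, ← expi_add, hφ]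
      congr 1
      push_cast
      ring
    rw [heq, norm_mul, norm_expi, one_mul]
    exact norm_sum_expi_mul_le (Nat.sub_le _ _) _
  have hsum : (∑ h ∈ Finset.range X, ∑ x ∈ Finset.range (X - (h + 1)),
      expi (φ (x + (h + 1)) * α) * (starRingEnd ℂ) (expi (φ x * α))).re ≤
      2 * weylSum X H α := by
    refine (Complex.re_le_norm _).trans ((norm_sum_le _ _).trans ?_)
    refine (Finset.sum_le_sum fun h _ => hinner h).trans ?_
    rw [← Finset.mul_sum]
    refine mul_le_mul_of_nonneg_left ?_ zero_le_two
    have hinj : Function.Injective fun h => d * (h + 1) := fun i j hij =>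
      Nat.add_right_cancel (Nat.eq_of_mul_eq_mul_left hd hij)
    rw [← Finset.sum_image (f := fun k : ℕ => (X : ℝ) / (1 + X * distInt (k * α)))
      (g := fun h => d * (h + 1)) hinj.injOn]
    refine Finset.sum_le_sum_of_subset_of_nonneg ?_ fun k _ _ => ?_
    · intro k hk
      obtain ⟨h, hh, rfl⟩ := Finset.mem_image.1 hk
      rw [Finset.mem_range] at hh
      exact Finset.mem_Icc.2 ⟨Nat.mul_pos hd h.succ_pos, (Nat.mul_le_mul_left d hh).trans hH⟩
    · have : 0 ≤ distInt (k * α) := abs_nonneg _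
      positivity
  linarith

/-- The generating exponential sum of the values of the form on a cube. -/
noncomputable def formSum (a b c X : ℕ) (α : ℝ) : ℂ :=
  ∑ v ∈ cube X, expi (triForm a b c v * α)

lemma formSum_eq_mul (a b c X : ℕ) (α : ℝ) : formSum a b c X α =
    (∑ x ∈ Finset.range X, expi ((a * x ^ 2 : ℕ) * α)) *
      ((∑ y ∈ Finset.range X, expi ((b * triangular y : ℕ) * α)) *
        ∑ z ∈ Finset.range X, expi ((c * triangular z : ℕ) * α)) := by
  rw [formSum, cube, Finset.sum_mul_sum, ← Finset.sum_product', Finset.sum_mul_sum,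
    ← Finset.sum_product']
  refine Finset.sum_congr rfl fun v _ => ?_
  rw [← expi_add, ← expi_add, triForm]
  congr 1
  push_cast
  ring

lemma triangular_add_mul (b x h : ℕ) :
    b * triangular (x + h) = b * triangular x + b * h * x + b * triangular h := by
  have h1 := two_mul_triangular (x + h)
  have h2 := two_mul_triangular x
  have h3 := two_mul_triangular h
  have h4 : triangular (x + h) = triangular x + h * x + triangular h := by nlinarith
  rw [h4]
  ring

lemma normSq_formSum_le {a b c X H : ℕ} (ha : 0 < a) (hb : 0 < b) (hc : 0 < c)
    (hH : (2 * a + b + c) * X ≤ H) (α : ℝ) :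
    ‖formSum a b c X α‖ ^ 2 ≤ 4 * (X : ℝ) ^ 3 + 256 * weylSum X H α ^ 3 := by
  have h1 := normSq_quadratic_sum_le (φ := fun x => a * x ^ 2) (ψ := fun h => a * h ^ 2)
    (d := 2 * a) (X := X) (H := H) (by omega) (by nlinarith) (fun x h => by ring) α
  have h2 := normSq_quadratic_sum_le (φ := fun x => b * triangular x)
    (ψ := fun h => b * triangular h) (X := X) (H := H) hb (by nlinarith) (triangular_add_mul b) α
  have h3 := normSq_quadratic_sum_le (φ := fun x => c * triangular x)
    (ψ := fun h => c * triangular h) (X := X) (H := H) hc (by nlinarith) (triangular_add_mul c) α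
  have hG := weylSum_nonneg X H α
  have hX : (0 : ℝ) ≤ X := Nat.cast_nonneg X
  calc ‖formSum a b c X α‖ ^ 2 ≤ (X + 4 * weylSum X H α) *
        ((X + 4 * weylSum X H α) * (X + 4 * weylSum X H α)) := by
        rw [formSum_eq_mul, norm_mul, norm_mul, mul_pow, mul_pow]
        gcongr
    _ ≤ _ := by
        have := mul_nonneg (add_nonneg hX (mul_nonneg zero_le_four hG))
          (sq_nonneg ((X : ℝ) - 4 * weylSum X H α))
        nlinarith

lemma sum_range_mul_zmod {q : ℕ} [NeZero q] (f : ZMod q → ℝ) (N : ℕ) :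
    ∑ h ∈ Finset.range (q * N), f h = N * ∑ r, f r := by
  induction N with
  | zero => simp
  | succ N ih =>
    rw [mul_add, mul_one, Finset.sum_range_add, ih]
    have h1 : ∑ x ∈ Finset.range q, f ((q * N + x : ℕ) : ZMod q) = ∑ r, f r := by
      obtain ⟨k, rfl⟩ : ∃ k, q = k + 1 := ⟨q - 1, by have := NeZero.pos q; omega⟩
      calc _ = ∑ x ∈ Finset.range (k + 1), f ((x : ℕ) : ZMod (k + 1)) := by
            refine Finset.sum_congr rfl fun x _ => ?_
            rw [Nat.cast_add, Nat.cast_mul, CharP.cast_eq_zero, zero_mul, zero_add]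
        _ = ∑ i : Fin (k + 1), f ((i : ℕ) : ZMod (k + 1)) :=
            (Fin.sum_univ_eq_sum_range (fun i => f ((i : ℕ) : ZMod (k + 1))) (k + 1)).symm
        _ = _ := Finset.sum_congr rfl fun i _ => by
            congr 1
            exact Fin.cast_val_eq_self i
    rw [h1]
    push_cast
    ring

/-- A majorant for the reciprocal of the distance from `r / q` to the nearest integer. -/
noncomputable def residueWeight (q : ℕ) (r : ZMod q) : ℝ :=
  if r = 0 then 0 else q * ((r.val : ℝ)⁻¹ + ((q : ℝ) - r.val)⁻¹)

lemma residueWeight_nonneg {q : ℕ} [NeZero q] (r : ZMod q) : 0 ≤ residueWeight q r := by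
  unfold residueWeight
  split_ifs
  · exact le_rfl
  · have : (r.val : ℝ) < q := by exact_mod_cast ZMod.val_lt r
    have : 0 ≤ (q : ℝ) - r.val := by linarith
    positivity

lemma sum_residueWeight_le {q : ℕ} [NeZero q] :
    ∑ r, residueWeight q r ≤ 2 * q * (1 + Real.log q) := by
  have hq : 0 < q := NeZero.pos q
  have h1 : ∑ r, residueWeight q r = ∑ r ∈ Finset.range q, residueWeight q r := by
    simpa using (sum_range_mul_zmod (residueWeight q) 1).symm
  have h2 : ∑ r ∈ Finset.range q, residueWeight q r ≤
      ∑ r ∈ Finset.range (q - 1), q * (((r + 1 : ℕ) : ℝ)⁻¹ + ((q - 1 - r : ℕ) : ℝ)⁻¹) := by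
    obtain ⟨k, rfl⟩ : ∃ k, q = k + 1 := ⟨q - 1, by omega⟩
    rw [Finset.sum_range_succ']
    have h0 : residueWeight (k + 1) ((0 : ℕ) : ZMod (k + 1)) = 0 := by simp [residueWeight]
    rw [h0, add_zero, Nat.add_sub_cancel]
    refine Finset.sum_le_sum fun r hr => ?_
    rw [Finset.mem_range] at hr
    have hval : (((r + 1 : ℕ) : ZMod (k + 1))).val = r + 1 := ZMod.val_cast_of_lt (by omega)
    unfold residueWeight
    split_ifs with h
    · positivity
    · rw [hval, Nat.cast_sub hr.le]
      push_cast
      rw [add_sub_add_right_eq_sub]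
  have h3 : ∑ r ∈ Finset.range (q - 1), ((q - 1 - r : ℕ) : ℝ)⁻¹ =
      ∑ r ∈ Finset.range (q - 1), ((r + 1 : ℕ) : ℝ)⁻¹ := by
    rw [← Finset.sum_range_reflect]
    refine Finset.sum_congr rfl fun r hr => ?_
    rw [Finset.mem_range] at hr
    congr 2
    omega
  have h4 : ∑ r ∈ Finset.range (q - 1), ((r + 1 : ℕ) : ℝ)⁻¹ ≤ 1 + Real.log q := by
    calc _ ≤ ∑ r ∈ Finset.range q, ((r + 1 : ℕ) : ℝ)⁻¹ :=
          Finset.sum_le_sum_of_subset_of_nonneg (Finset.range_mono (Nat.sub_le _ _))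
            fun _ _ _ => by positivity
      _ = (harmonic q : ℝ) := by simp [harmonic]
      _ ≤ _ := harmonic_le_one_add_log q
  rw [h1]
  refine h2.trans ?_
  rw [← Finset.mul_sum, Finset.sum_add_distrib, h3]
  have : (0 : ℝ) ≤ q := Nat.cast_nonneg q
  nlinarith

lemma one_le_abs_sub_mul_residueWeight {q : ℕ} [NeZero q] {k : ℤ} (hk : (k : ZMod q) ≠ 0) (m : ℤ) :
    1 ≤ |(k : ℝ) / q - m| * residueWeight q k := by
  have hq : (0 : ℝ) < q := by exact_mod_cast NeZero.pos q
  set r := (k : ZMod q).val with hr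
  have hr0 : 0 < r := Nat.pos_of_ne_zero fun h => hk ((ZMod.val_eq_zero _).1 h)
  have hrq : r < q := ZMod.val_lt _
  obtain ⟨j, hj⟩ : ∃ j : ℤ, k - m * q = r + j * q := by
    have h1 : ((k - r : ℤ) : ZMod q) = 0 := by simp [hr]
    obtain ⟨j, hj⟩ := (ZMod.intCast_zmod_eq_zero_iff_dvd _ _).1 h1
    exact ⟨j - m, by linear_combination hj⟩
  have hj' : (k : ℝ) / q - m = (r + j * q) / q := by
    rw [← sub_eq_zero]
    field_simp
    have : (k : ℝ) - m * q = r + j * q := by exact_mod_cast hj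
    linarith
  have hr0' : (0 : ℝ) < r := by exact_mod_cast hr0
  have hrq' : (0 : ℝ) < q - r := by
    have : (r : ℝ) < q := by exact_mod_cast hrq
    linarith
  rw [residueWeight, if_neg hk, ← hr, hj', abs_div, abs_of_pos hq]
  have hmul : |(r : ℝ) + j * q| / q * (q * ((r : ℝ)⁻¹ + ((q : ℝ) - r)⁻¹)) =
      |(r : ℝ) + j * q| * (r : ℝ)⁻¹ + |(r : ℝ) + j * q| * ((q : ℝ) - r)⁻¹ := by
    field_simp
  rw [hmul]
  have habs := abs_nonneg ((r : ℝ) + j * q)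
  rcases le_or_gt 0 j with h | h
  · have hj0 : (0 : ℝ) ≤ j := by exact_mod_cast h
    have h1 : (r : ℝ) ≤ |(r : ℝ) + j * q| := (by nlinarith : (r : ℝ) ≤ r + j * q).trans (le_abs_self _)
    have h2 : 1 ≤ |(r : ℝ) + j * q| * (r : ℝ)⁻¹ := by
      rw [← div_eq_mul_inv, le_div_iff₀ hr0']; linarith
    have h3 : 0 ≤ |(r : ℝ) + j * q| * ((q : ℝ) - r)⁻¹ := by positivity
    linarith
  · have hj0 : (j : ℝ) ≤ -1 := by exact_mod_cast Int.le_sub_one_of_lt h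
    have h1 : (q : ℝ) - r ≤ |(r : ℝ) + j * q| :=
      (by nlinarith : (q : ℝ) - r ≤ -(r + j * q)).trans (neg_le_abs _)
    have h2 : 1 ≤ |(r : ℝ) + j * q| * ((q : ℝ) - r)⁻¹ := by
      rw [← div_eq_mul_inv, le_div_iff₀ hrq']; linarith
    have h3 : 0 ≤ |(r : ℝ) + j * q| * (r : ℝ)⁻¹ := by positivity
    linarith

lemma inv_le_abs_sub_of_intCast_ne_zero {q : ℕ} [NeZero q] {k : ℤ} (hk : (k : ZMod q) ≠ 0) (m : ℤ) :
    (q : ℝ)⁻¹ ≤ |(k : ℝ) / q - m| := by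
  have hq : (0 : ℝ) < q := by exact_mod_cast NeZero.pos q
  have hne : k - m * q ≠ 0 := fun h => hk (by
    have := congrArg (Int.cast : ℤ → ZMod q) (sub_eq_zero.1 h)
    simpa using this)
  have h1 : (1 : ℝ) ≤ |((k - m * q : ℤ) : ℝ)| := by
    exact_mod_cast Int.one_le_abs hne
  have h2 : (k : ℝ) / q - m = ((k - m * q : ℤ) : ℝ) / q := by
    push_cast; field_simp
  rw [h2, abs_div, abs_of_pos hq, inv_eq_one_div]
  gcongr

lemma div_one_add_le_residueWeight {q X h : ℕ} [NeZero q] {p : ℤ} {α : ℝ}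
    (hα : |h * (α - p / q)| ≤ (2 * q : ℝ)⁻¹) (hh : ((h * p : ℤ) : ZMod q) ≠ 0) :
    (X : ℝ) / (1 + X * distInt (h * α)) ≤ 2 * residueWeight q ((h * p : ℤ) : ZMod q) := by
  have hX : (0 : ℝ) ≤ X := Nat.cast_nonneg X
  have hd : 0 ≤ distInt (h * α) := abs_nonneg _
  have hw := residueWeight_nonneg ((h * p : ℤ) : ZMod q)
  have h1 := one_le_abs_sub_mul_residueWeight hh (round (h * α))
  have h2 := inv_le_abs_sub_of_intCast_ne_zero hh (round (h * α))
  have h3 : |((h * p : ℤ) : ℝ) / q - round (h * α)| ≤ distInt (h * α) + |h * (α - p / q)| := by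
    rw [distInt, abs_sub_comm, abs_sub_comm (_ : ℝ) ((round (h * α) : ℤ) : ℝ)]
    refine le_trans (le_of_eq ?_) (abs_add_le _ _)
    congr 1
    push_cast
    ring
  have h4 : (2 * q : ℝ)⁻¹ = (q : ℝ)⁻¹ / 2 := by rw [mul_inv]; ring
  have h5 : |((h * p : ℤ) : ℝ) / q - round (h * α)| ≤ 2 * distInt (h * α) := by linarith
  have h6 : 1 ≤ 2 * distInt (h * α) * residueWeight q ((h * p : ℤ) : ZMod q) :=
    h1.trans (mul_le_mul_of_nonneg_right h5 hw)
  rw [div_le_iff₀ (by positivity)]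
  nlinarith

lemma distInt_mul_eq {q k : ℕ} [NeZero q] {p : ℤ} {α : ℝ}
    (hα : |((q * k : ℕ) : ℝ) * (α - p / q)| < 1 / 2) :
    distInt ((q * k : ℕ) * α) = k * (q * |α - p / q|) := by
  have hq : (q : ℝ) ≠ 0 := by exact_mod_cast NeZero.ne q
  have h1 : ((q * k : ℕ) : ℝ) * α = ((q * k : ℕ) : ℝ) * (α - p / q) + ((k * p : ℤ) : ℝ) := by
    push_cast
    field_simp
    ring
  have h2 : round (((q * k : ℕ) : ℝ) * (α - p / q)) = 0 := by
    rw [round_eq_zero_iff]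
    rw [abs_lt] at hα
    exact ⟨hα.1.le, hα.2⟩
  rw [distInt, h1, round_add_intCast, h2, zero_add, add_sub_cancel_right, abs_mul, Nat.abs_cast]
  push_cast
  ring

lemma sum_div_one_add_le_log {X : ℕ} {γ : ℝ} (hγ : 0 ≤ γ) (Y : ℕ) :
    γ * ∑ k ∈ Finset.Icc 1 Y, (X : ℝ) / (1 + X * (k * γ)) ≤ Real.log (1 + X * Y * γ) := by
  induction Y with
  | zero => simp
  | succ Y ih =>
    rw [Finset.sum_Icc_succ_top (by omega : 1 ≤ Y + 1), mul_add]
    have hX : (0 : ℝ) ≤ X := Nat.cast_nonneg X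
    have h1 : 0 < 1 + (X : ℝ) * Y * γ := by positivity
    have h2 : 0 < 1 + (X : ℝ) * (Y + 1 : ℕ) * γ := by positivity
    have h3 := Real.one_sub_inv_le_log_of_pos (div_pos h2 h1)
    rw [Real.log_div h2.ne' h1.ne', inv_div] at h3
    have h4 : γ * (X / (1 + X * ((Y + 1 : ℕ) * γ))) =
        1 - (1 + (X : ℝ) * Y * γ) / (1 + (X : ℝ) * (Y + 1 : ℕ) * γ) := by
      rw [← mul_assoc]
      field_simp
      push_cast
      ring
    linarith

lemma sum_div_one_add_pow_three_le {X Y : ℕ} {γ : ℝ} (hγ : 0 ≤ γ) :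
    (∑ k ∈ Finset.Icc 1 Y, (X : ℝ) / (1 + X * (k * γ))) ^ 3 * (1 + (X * Y * γ) ^ 2) ≤
      24 * (X * Y : ℝ) ^ 3 := by
  set A := ∑ k ∈ Finset.Icc 1 Y, (X : ℝ) / (1 + X * (k * γ)) with hA
  have hA0 : 0 ≤ A := Finset.sum_nonneg fun k _ => by positivity
  have hA1 : A ≤ X * Y := by
    calc A ≤ ∑ k ∈ Finset.Icc 1 Y, (X : ℝ) :=
          Finset.sum_le_sum fun k _ => div_le_self (Nat.cast_nonneg X)
            (le_add_of_nonneg_right (by positivity))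
      _ = X * Y := by simp [mul_comm]
  have hlog := sum_div_one_add_le_log (X := X) hγ Y
  rw [← hA] at hlog
  set u := (X : ℝ) * Y * γ with hu
  have hu0 : 0 ≤ u := by positivity
  have hA3 : A ^ 3 ≤ (X * Y : ℝ) ^ 3 := pow_le_pow_left₀ hA0 hA1 3
  rcases le_total u 1 with h | h
  · have : u ^ 2 ≤ 1 := pow_le_one₀ hu0 h
    have := pow_nonneg hA0 3
    nlinarith
  · have hγ0 : 0 < γ := by
      refine lt_of_le_of_ne hγ fun h0 => ?_
      rw [hu, ← h0] at h
      norm_num at h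
    have hl0 : 0 ≤ Real.log (1 + u) := Real.log_nonneg (by linarith)
    have h1 : Real.log (1 + u) ^ 3 ≤ 6 * (1 + u) := by
      have := Real.pow_div_factorial_le_exp (Real.log (1 + u)) hl0 3
      rw [Real.exp_log (by linarith)] at this
      norm_num [Nat.factorial] at this
      linarith
    have h2 : γ ^ 3 * A ^ 3 ≤ 6 * (1 + u) := by
      rw [← mul_pow]
      exact (pow_le_pow_left₀ (by positivity) hlog 3).trans h1
    have h3 : 6 * (1 + u) * (1 + u ^ 2) ≤ 24 * u ^ 3 := by
      nlinarith [mul_nonneg (sub_nonneg.2 h) hu0, mul_nonneg (sub_nonneg.2 h) (sq_nonneg u)]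
    have h4 : γ ^ 3 * (A ^ 3 * (1 + u ^ 2)) ≤ γ ^ 3 * (24 * (X * Y : ℝ) ^ 3) := by
      calc _ = γ ^ 3 * A ^ 3 * (1 + u ^ 2) := by ring
        _ ≤ 6 * (1 + u) * (1 + u ^ 2) := by gcongr
        _ ≤ 24 * u ^ 3 := h3
        _ = _ := by rw [hu]; ring
    exact le_of_mul_le_mul_left h4 (by positivity)

lemma sum_not_dvd_le {X H q : ℕ} {p : ℤ} {α : ℝ} (hq : 0 < q) (hqH : q ≤ 2 * H)
    (hpq : IsCoprime (q : ℤ) p) (hα : ∀ h ∈ Finset.Icc 1 H, |h * (α - p / q)| ≤ (2 * q : ℝ)⁻¹) :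
    ∑ h ∈ Finset.Icc 1 H with ¬ q ∣ h, (X : ℝ) / (1 + X * distInt (h * α)) ≤
      12 * H * (1 + Real.log (2 * H)) := by
  have : NeZero q := ⟨hq.ne'⟩
  have hu : IsUnit (p : ZMod q) := (ZMod.coe_int_isUnit_iff_isCoprime p q).2 hpq
  have hlog : Real.log q ≤ Real.log (2 * H) :=
    Real.log_le_log (by exact_mod_cast hq) (by exact_mod_cast hqH)
  have hlog0 : 0 ≤ Real.log q := Real.log_natCast_nonneg q
  calc _ ≤ ∑ h ∈ Finset.Icc 1 H with ¬ q ∣ h, 2 * residueWeight q ((h : ZMod q) * p) := by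
        refine Finset.sum_le_sum fun h hh => ?_
        rw [Finset.mem_filter] at hh
        have hne : ((h * p : ℤ) : ZMod q) ≠ 0 := by
          push_cast
          rw [Ne, hu.mul_left_eq_zero, ZMod.natCast_eq_zero_iff]
          exact hh.2
        simpa using div_one_add_le_residueWeight (X := X) (hα h hh.1) hne
    _ ≤ ∑ h ∈ Finset.range (q * (H / q + 1)), 2 * residueWeight q ((h : ZMod q) * p) := by
        refine Finset.sum_le_sum_of_subset_of_nonneg (fun h hh => ?_) fun h _ _ =>
          mul_nonneg zero_le_two (residueWeight_nonneg _)
        rw [Finset.mem_filter, Finset.mem_Icc] at hh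
        exact Finset.mem_range.2 (hh.1.2.trans_lt (Nat.lt_mul_div_succ H hq))
    _ = (H / q + 1 : ℕ) * ∑ r : ZMod q, 2 * residueWeight q (r * p) :=
        sum_range_mul_zmod (fun r : ZMod q => 2 * residueWeight q (r * p)) _
    _ = (H / q + 1 : ℕ) * (2 * ∑ r : ZMod q, residueWeight q r) := by
        rw [← Finset.mul_sum, ← Equiv.sum_comp (Units.mulRight hu.unit) (residueWeight q)]
        simp
    _ ≤ (H / q + 1 : ℕ) * (2 * (2 * q * (1 + Real.log q))) := by
        gcongr
        exact sum_residueWeight_le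
    _ = (4 * ((H / q * q + q : ℕ) : ℝ)) * (1 + Real.log q) := by
        push_cast; ring
    _ ≤ (4 * ((3 * H : ℕ) : ℝ)) * (1 + Real.log (2 * H)) := by
        have : H / q * q + q ≤ 3 * H := by
          have := Nat.div_mul_le_self H q
          omega
        gcongr
    _ = _ := by push_cast; ring

lemma sum_dvd_pow_three_le {X H q : ℕ} {p : ℤ} {α : ℝ} (hq : 0 < q)
    (hα : ∀ h ∈ Finset.Icc 1 H, |h * (α - p / q)| < 1 / 2) :
    (∑ h ∈ Finset.Icc 1 H with q ∣ h, (X : ℝ) / (1 + X * distInt (h * α))) ^ 3 ≤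
      96 * (X * H : ℝ) ^ 3 / q ^ 3 * (1 + (X * H * (α - p / q)) ^ 2)⁻¹ := by
  have : NeZero q := ⟨hq.ne'⟩
  have hq' : (0 : ℝ) < q := by exact_mod_cast hq
  set γ := q * |α - p / q| with hγ
  have hγ0 : 0 ≤ γ := by positivity
  have hsum : ∑ h ∈ Finset.Icc 1 H with q ∣ h, (X : ℝ) / (1 + X * distInt (h * α)) =
      ∑ k ∈ Finset.Icc 1 (H / q), (X : ℝ) / (1 + X * (k * γ)) := by
    have himage : {h ∈ Finset.Icc 1 H | q ∣ h} = (Finset.Icc 1 (H / q)).image (q * ·) := by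
      ext h
      simp only [Finset.mem_filter, Finset.mem_Icc, Finset.mem_image]
      constructor
      · rintro ⟨⟨h1, h2⟩, k, rfl⟩
        exact ⟨k, ⟨Nat.pos_of_mul_pos_left h1, (Nat.le_div_iff_mul_le hq).2 (by rwa [mul_comm])⟩, rfl⟩
      · rintro ⟨k, ⟨h1, h2⟩, rfl⟩
        have h3 := (Nat.le_div_iff_mul_le hq).1 h2
        exact ⟨⟨Nat.mul_pos hq h1, by rwa [mul_comm]⟩, dvd_mul_right q k⟩
    have hinj : Function.Injective (q * ·) := fun i j hij => Nat.eq_of_mul_eq_mul_left hq hij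
    have hmem : ∀ k ∈ Finset.Icc 1 (H / q), q * k ∈ Finset.Icc 1 H := fun k hk =>
      (Finset.mem_filter.1 (himage ▸ Finset.mem_image_of_mem (q * ·) hk)).1
    rw [himage, Finset.sum_image hinj.injOn]
    refine Finset.sum_congr rfl fun k hk => ?_
    rw [distInt_mul_eq (hα _ (hmem k hk))]
  rw [hsum]
  rcases Nat.eq_zero_or_pos (H / q) with hY | hY
  · rw [hY]
    simp only [zero_lt_one, Finset.Icc_eq_empty_of_lt, Finset.sum_empty]
    rw [zero_pow three_ne_zero]
    positivity
  have h1 := sum_div_one_add_pow_three_le (X := X) (Y := H / q) hγ0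
  set A := ∑ k ∈ Finset.Icc 1 (H / q), (X : ℝ) / (1 + X * (k * γ)) with hA
  have hA0 : 0 ≤ A := Finset.sum_nonneg fun k _ => by positivity
  have hYH : ((H / q : ℕ) : ℝ) * q ≤ H := by exact_mod_cast Nat.div_mul_le_self H q
  have hHY : (H : ℝ) ≤ 2 * (((H / q : ℕ) : ℝ) * q) := by
    have := Nat.lt_mul_div_succ H hq
    have h2 : H ≤ 2 * (H / q * q) := by nlinarith
    exact_mod_cast h2
  have ht : (X * H * (α - p / q)) ^ 2 ≤ 4 * (X * (H / q : ℕ) * γ) ^ 2 := by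
    have h2 : X * H * |α - p / q| ≤ 2 * (X * (H / q : ℕ) * γ) := by
      rw [hγ]
      have h3 : 0 ≤ X * |α - p / q| := by positivity
      nlinarith
    calc (X * H * (α - p / q)) ^ 2 = (X * H * |α - p / q|) ^ 2 := by
          rw [mul_pow, mul_pow _ |_|, sq_abs]
      _ ≤ (2 * (X * (H / q : ℕ) * γ)) ^ 2 := by gcongr
      _ = _ := by ring
  rw [← div_eq_mul_inv, le_div_iff₀ (by positivity), le_div_iff₀ (by positivity)]
  have hXY : X * ((H / q : ℕ) : ℝ) * q ≤ X * H := by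
    rw [mul_assoc]; gcongr
  calc A ^ 3 * (1 + (X * H * (α - p / q)) ^ 2) * q ^ 3
      ≤ A ^ 3 * (4 * (1 + (X * (H / q : ℕ) * γ) ^ 2)) * q ^ 3 := by
        gcongr
        linarith
    _ = 4 * (A ^ 3 * (1 + (X * (H / q : ℕ) * γ) ^ 2)) * q ^ 3 := by ring
    _ ≤ 4 * (24 * (X * (H / q : ℕ) : ℝ) ^ 3) * q ^ 3 := by gcongr
    _ = 96 * (X * (H / q : ℕ) * q : ℝ) ^ 3 := by ring
    _ ≤ _ := by gcongr

lemma weylSum_pow_three_le {X H q : ℕ} {p : ℤ} {α : ℝ} (hq : 0 < q) (hqH : q ≤ 2 * H)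
    (hpq : IsCoprime (q : ℤ) p) (hα : |α - p / q| ≤ 1 / (((2 * H : ℕ) + 1) * q)) :
    weylSum X H α ^ 3 ≤
      384 * (X * H : ℝ) ^ 3 / q ^ 3 * (1 + (X * H * (α - p / q)) ^ 2)⁻¹ +
        4 * (12 * H * (1 + Real.log (2 * H))) ^ 3 := by
  have hq' : (1 : ℝ) ≤ q := by exact_mod_cast hq
  have hsmall : ∀ h ∈ Finset.Icc 1 H, |h * (α - p / q)| < (2 * q : ℝ)⁻¹ := by
    intro h hh
    have hh' : (h : ℝ) ≤ H := by exact_mod_cast (Finset.mem_Icc.1 hh).2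
    rw [abs_mul, Nat.abs_cast]
    calc (h : ℝ) * |α - p / q| ≤ H * (1 / (((2 * H : ℕ) + 1) * q)) := by gcongr
      _ < (2 * q : ℝ)⁻¹ := by
        push_cast
        rw [mul_one_div, inv_eq_one_div, div_lt_div_iff₀ (by positivity) (by positivity)]
        nlinarith
  have hhalf : (2 * q : ℝ)⁻¹ ≤ 1 / 2 := by
    rw [inv_eq_one_div]
    gcongr
    linarith
  have h1 := sum_not_dvd_le (X := X) hq hqH hpq fun h hh => (hsmall h hh).le
  have h2 := sum_dvd_pow_three_le (X := X) hq fun h hh => (hsmall h hh).trans_le hhalf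
  have hpos : ∀ h : ℕ, 0 ≤ (X : ℝ) / (1 + X * distInt (h * α)) := fun h => by
    have : 0 ≤ distInt (h * α) := abs_nonneg _
    positivity
  rw [weylSum, ← Finset.sum_filter_add_sum_filter_not _ (q ∣ ·)]
  set A := ∑ h ∈ Finset.Icc 1 H with q ∣ h, (X : ℝ) / (1 + X * distInt (h * α))
  set B := ∑ h ∈ Finset.Icc 1 H with ¬ q ∣ h, (X : ℝ) / (1 + X * distInt (h * α))
  have hA : 0 ≤ A := Finset.sum_nonneg fun h _ => hpos h
  have hB : 0 ≤ B := Finset.sum_nonneg fun h _ => hpos h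
  have h3 : B ^ 3 ≤ (12 * H * (1 + Real.log (2 * H))) ^ 3 := pow_le_pow_left₀ hB h1 3
  have h4 : (A + B) ^ 3 ≤ 4 * A ^ 3 + 4 * B ^ 3 := by
    nlinarith [mul_nonneg (add_nonneg hA hB) (sq_nonneg (A - B))]
  calc (A + B) ^ 3 ≤ 4 * A ^ 3 + 4 * B ^ 3 := h4
    _ ≤ 4 * (96 * (X * H : ℝ) ^ 3 / q ^ 3 * (1 + (X * H * (α - p / q)) ^ 2)⁻¹) +
        4 * (12 * H * (1 + Real.log (2 * H))) ^ 3 := by gcongr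
    _ = _ := by ring

/-- The Cauchy kernel of scale `l`. -/
noncomputable def cauchyKernel (l β : ℝ) : ℝ := (1 + (l * β) ^ 2)⁻¹

lemma cauchyKernel_nonneg (l β : ℝ) : 0 ≤ cauchyKernel l β := by
  unfold cauchyKernel
  positivity

@[fun_prop]
lemma continuous_cauchyKernel (l : ℝ) : Continuous (cauchyKernel l) := by
  unfold cauchyKernel
  exact Continuous.inv₀ (by fun_prop) fun β => by positivity

lemma integral_cauchyKernel_le {l : ℝ} (hl : 0 < l) (x : ℝ) :
    ∫ α in (0 : ℝ)..1, cauchyKernel l (α - x) ≤ Real.pi / l := by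
  have hcint : MeasureTheory.Integrable (cauchyKernel l) :=
    integrable_inv_one_add_sq.comp_mul_left' hl.ne'
  rw [intervalIntegral.integral_of_le zero_le_one]
  refine (MeasureTheory.setIntegral_le_integral (hcint.comp_sub_right x)
    (Filter.Eventually.of_forall fun α => cauchyKernel_nonneg _ _)).trans (le_of_eq ?_)
  rw [MeasureTheory.integral_sub_right_eq_self (cauchyKernel l) x]
  have h1 := MeasureTheory.Measure.integral_comp_mul_left (fun x : ℝ => (1 + x ^ 2)⁻¹) l
  rw [integral_univ_inv_one_add_sq, abs_of_pos (inv_pos.2 hl), smul_eq_mul] at h1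
  unfold cauchyKernel
  rw [h1, mul_comm, div_eq_mul_inv]

/-- The weight of the arcs around fractions with denominator `q`. -/
noncomputable def arcWeight (X H P s q : ℕ) : ℝ :=
  98304 * (X * H : ℝ) ^ 3 / q ^ 3 * if P < q then 4 else 8 * (Real.pi * s / (X * H)) ^ 2

/-- The scale of the arcs around fractions with denominator `q`. -/
noncomputable def arcScale (X H P s q : ℕ) : ℝ := if P < q then X * H else Real.pi * s

/-- The contribution of the minor terms in the cube of the Weyl majorant. -/
noncomputable def minorError (X H : ℕ) : ℝ :=
  16 * (X : ℝ) ^ 3 + 4096 * (12 * H * (1 + Real.log (2 * H))) ^ 3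

lemma arcWeight_nonneg (X H P s q : ℕ) : 0 ≤ arcWeight X H P s q := by
  unfold arcWeight
  split_ifs <;> positivity

lemma norm_expi_sub_one_sq_mul_le {X H P s q : ℕ} {p : ℤ} {α : ℝ} (hX : 0 < X) (hH : 0 < H)
    (hq : 0 < q) (hs : q ≤ P → q ∣ s) :
    ‖expi (s * α) - 1‖ ^ 2 * (98304 * (X * H : ℝ) ^ 3 / q ^ 3 *
      (1 + (X * H * (α - p / q)) ^ 2)⁻¹) ≤
      arcWeight X H P s q * cauchyKernel (arcScale X H P s q) (α - p / q) := by
  have hM : 0 ≤ 98304 * (X * H : ℝ) ^ 3 / q ^ 3 := by positivity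
  have h4 : ‖expi (s * α) - 1‖ ^ 2 ≤ 4 := by
    have := norm_expi_sub_one_le_two (s * α)
    have h0 := norm_nonneg (expi (s * α) - 1)
    nlinarith
  unfold arcWeight arcScale cauchyKernel
  split_ifs with h
  · calc _ ≤ 4 * (98304 * (X * H : ℝ) ^ 3 / q ^ 3 * (1 + (X * H * (α - p / q)) ^ 2)⁻¹) := by
          gcongr
      _ = _ := by ring
  · obtain ⟨k, rfl⟩ := hs (not_lt.1 h)
    have hq' : (q : ℝ) ≠ 0 := by exact_mod_cast hq.ne'
    set v := Real.pi * ((q * k : ℕ) : ℝ) * (α - p / q) with hv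
    have hw : ‖expi ((q * k : ℕ) * α) - 1‖ ^ 2 ≤ 4 * v ^ 2 := by
      have h1 : expi ((q * k : ℕ) * α) = expi ((q * k : ℕ) * (α - p / q)) := by
        rw [← expi_add_intCast (((q * k : ℕ) : ℝ) * (α - p / q)) (k * p)]
        congr 1
        push_cast
        field_simp
        ring
      have h2 := norm_expi_sub_one_le ((q * k : ℕ) * (α - p / q))
      rw [← h1] at h2
      calc _ ≤ (2 * Real.pi * |((q * k : ℕ) : ℝ) * (α - p / q)|) ^ 2 := by gcongr
        _ = _ := by rw [mul_pow _ |_|, sq_abs, hv]; ring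
    set w := ‖expi ((q * k : ℕ) * α) - 1‖ ^ 2
    have hX' : (X : ℝ) * H ≠ 0 := by positivity
    have hkey : w * (1 + (X * H * (α - p / q)) ^ 2)⁻¹ ≤
        8 * (Real.pi * (q * k : ℕ) / (X * H)) ^ 2 * (1 + v ^ 2)⁻¹ := by
      rw [← div_eq_mul_inv, ← div_eq_mul_inv, div_le_div_iff₀ (by positivity) (by positivity)]
      have h5 : 8 * (Real.pi * (q * k : ℕ) / (X * H)) ^ 2 * (1 + (X * H * (α - p / q)) ^ 2) =
          8 * (Real.pi * (q * k : ℕ) / (X * H)) ^ 2 + 8 * v ^ 2 := by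
        rw [hv]
        field_simp
      rw [h5]
      nlinarith [sq_nonneg v, sq_nonneg (Real.pi * (q * k : ℕ) / (X * H))]
    calc _ = 98304 * (X * H : ℝ) ^ 3 / q ^ 3 * (w * (1 + (X * H * (α - p / q)) ^ 2)⁻¹) := by ring
      _ ≤ 98304 * (X * H : ℝ) ^ 3 / q ^ 3 *
          (8 * (Real.pi * (q * k : ℕ) / (X * H)) ^ 2 * (1 + v ^ 2)⁻¹) := by gcongr
      _ = _ := by ring

lemma normSq_formSum_mul_le {a b c X H P s : ℕ} (ha : 0 < a) (hb : 0 < b) (hc : 0 < c)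
    (hX : 0 < X) (hH : (2 * a + b + c) * X ≤ H) (hs : ∀ q, 0 < q → q ≤ P → q ∣ s)
    {α : ℝ} (hα : α ∈ Set.Icc (0 : ℝ) 1) :
    ‖formSum a b c X α‖ ^ 2 * ‖expi (s * α) - 1‖ ^ 2 ≤ minorError X H +
      ∑ q ∈ Finset.Icc 1 (2 * H), ∑ p ∈ Finset.range (q + 1),
        arcWeight X H P s q * cauchyKernel (arcScale X H P s q) (α - p / q) := by
  have hH0 : 0 < H := lt_of_lt_of_le (by positivity) hH
  obtain ⟨ρ, hρ, hden⟩ := Real.exists_rat_abs_sub_le_and_den_le α (n := 2 * H) (by omega)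
  have hq0 : (0 : ℝ) < ρ.den := by exact_mod_cast ρ.den_pos
  have hcop : IsCoprime (ρ.den : ℤ) ρ.num := by
    rw [Int.isCoprime_iff_gcd_eq_one, Int.gcd_comm]
    exact ρ.reduced
  rw [Rat.cast_def] at hρ
  have hsmall : |α - ρ.num / ρ.den| < 1 / ρ.den := by
    refine hρ.trans_lt ?_
    rw [div_lt_div_iff₀ (by positivity) hq0]
    have : (1 : ℝ) ≤ (2 * H : ℕ) := by exact_mod_cast (by omega : 1 ≤ 2 * H)
    nlinarith
  have hnum : 0 ≤ ρ.num ∧ ρ.num ≤ ρ.den := by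
    have h1 := abs_lt.1 hsmall
    constructor
    · have h2 : (-1 : ℝ) < ρ.num := by
        have h3 : -(1 : ℝ) / ρ.den < ρ.num / ρ.den := by
          have := hα.1
          rw [neg_div]; linarith
        exact (div_lt_div_iff_of_pos_right hq0).1 h3
      have : (-1 : ℤ) < ρ.num := by exact_mod_cast h2
      omega
    · have h2 : (ρ.num : ℝ) < ρ.den + 1 := by
        have h3 : (ρ.num : ℝ) / ρ.den < (ρ.den + 1) / ρ.den := by
          have := hα.2
          rw [add_div, div_self hq0.ne']; linarith
        exact (div_lt_div_iff_of_pos_right hq0).1 h3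
      have : ρ.num < ρ.den + 1 := by exact_mod_cast h2
      omega
  obtain ⟨p, hp⟩ := Int.eq_ofNat_of_zero_le hnum.1
  rw [hp] at hρ hnum hcop
  set w := ‖expi (s * α) - 1‖ ^ 2 with hw
  have hw0 : 0 ≤ w := by positivity
  have hw4 : w ≤ 4 := by
    have := norm_expi_sub_one_le_two (s * α)
    have h0 := norm_nonneg (expi (s * α) - 1)
    nlinarith
  have hF := normSq_formSum_le ha hb hc hH α
  have hG := weylSum_pow_three_le (X := X) ρ.den_pos hden hcop hρ
  have harc := norm_expi_sub_one_sq_mul_le (P := P) (p := p) (α := α) hX hH0 ρ.den_pos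
    (hs _ ρ.den_pos)
  rw [← hw] at harc
  have hmem : arcWeight X H P s ρ.den * cauchyKernel (arcScale X H P s ρ.den) (α - p / ρ.den) ≤
      ∑ q ∈ Finset.Icc 1 (2 * H), ∑ p ∈ Finset.range (q + 1),
        arcWeight X H P s q * cauchyKernel (arcScale X H P s q) (α - p / q) := by
    have hnn : ∀ q p : ℕ,
        0 ≤ arcWeight X H P s q * cauchyKernel (arcScale X H P s q) (α - p / q) := fun q p =>
      mul_nonneg (arcWeight_nonneg _ _ _ _ _) (cauchyKernel_nonneg _ _)
    refine le_trans ?_ (Finset.single_le_sum (f := fun q : ℕ => ∑ p ∈ Finset.range (q + 1),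
      arcWeight X H P s q * cauchyKernel (arcScale X H P s q) (α - p / q))
      (fun q _ => Finset.sum_nonneg fun p _ => hnn q p)
      (Finset.mem_Icc.2 ⟨ρ.den_pos, hden⟩))
    exact Finset.single_le_sum (f := fun p : ℕ =>
      arcWeight X H P s ρ.den * cauchyKernel (arcScale X H P s ρ.den) (α - p / ρ.den))
      (fun p _ => hnn ρ.den p) (Finset.mem_range.2 (by omega))
  have hlog : 0 ≤ 1 + Real.log (2 * H) := by
    have := Real.log_natCast_nonneg (2 * H)
    push_cast at this
    linarith
  have hB : 0 ≤ (12 * H * (1 + Real.log (2 * H))) ^ 3 := by positivity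
  refine le_trans ?_ (add_le_add_right hmem _)
  refine le_trans ?_ (add_le_add_right harc _)
  unfold minorError
  calc ‖formSum a b c X α‖ ^ 2 * w
      ≤ (4 * (X : ℝ) ^ 3 + 256 * weylSum X H α ^ 3) * w := by gcongr
    _ ≤ (4 * (X : ℝ) ^ 3 + 256 * (384 * (X * H : ℝ) ^ 3 / ρ.den ^ 3 *
          (1 + (X * H * (α - p / ρ.den)) ^ 2)⁻¹ + 4 * (12 * H * (1 + Real.log (2 * H))) ^ 3)) * w := by
        gcongr
        simpa using hG
    _ = (4 * (X : ℝ) ^ 3 + 1024 * (12 * H * (1 + Real.log (2 * H))) ^ 3) * w +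
          w * (98304 * (X * H : ℝ) ^ 3 / ρ.den ^ 3 * (1 + (X * H * (α - p / ρ.den)) ^ 2)⁻¹) := by
        ring
    _ ≤ (4 * (X : ℝ) ^ 3 + 1024 * (12 * H * (1 + Real.log (2 * H))) ^ 3) * 4 +
          w * (98304 * (X * H : ℝ) ^ 3 / ρ.den ^ 3 * (1 + (X * H * (α - p / ρ.den)) ^ 2)⁻¹) := by
        gcongr
    _ = _ := by push_cast; ring

lemma sum_Icc_inv_sq_le_two (n : ℕ) : ∑ q ∈ Finset.Icc 1 n, ((q : ℝ) ^ 2)⁻¹ ≤ 2 := by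
  rcases Nat.eq_zero_or_pos n with rfl | hn
  · simp
  have h1 : Finset.Icc 1 n = insert 1 (Finset.Ioc 1 n) := by
    ext; simp only [Finset.mem_Icc, Finset.mem_insert, Finset.mem_Ioc]; omega
  rw [h1, Finset.sum_insert (by simp)]
  have h2 := sum_Ioc_inv_sq_le_sub (α := ℝ) one_ne_zero hn
  have h3 : (0 : ℝ) ≤ (n : ℝ)⁻¹ := by positivity
  norm_num at h2 ⊢
  linarith

lemma sum_Ioc_inv_sq_le_inv {P : ℕ} (hP : 0 < P) (n : ℕ) :
    ∑ q ∈ Finset.Ioc P n, ((q : ℝ) ^ 2)⁻¹ ≤ (P : ℝ)⁻¹ := by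
  rcases le_or_gt P n with h | h
  · have h2 := sum_Ioc_inv_sq_le_sub (α := ℝ) hP.ne' h
    have h3 : (0 : ℝ) ≤ (n : ℝ)⁻¹ := by positivity
    linarith
  · rw [Finset.Ioc_eq_empty (by omega), Finset.sum_empty]
    positivity

lemma integral_normSq_formSum_mul_le {a b c X H P s : ℕ} (ha : 0 < a) (hb : 0 < b) (hc : 0 < c)
    (hX : 0 < X) (hH : (2 * a + b + c) * X ≤ H) (hP : 0 < P) (hs0 : 0 < s)
    (hs : ∀ q, 0 < q → q ≤ P → q ∣ s) :
    ∫ α in (0 : ℝ)..1, ‖formSum a b c X α‖ ^ 2 * ‖expi (s * α) - 1‖ ^ 2 ≤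
      minorError X H + 98304 * (32 * Real.pi ^ 2) * (s * (X * H)) +
        98304 * (8 * Real.pi) * ((X * H : ℝ) ^ 2 / P) := by
  have hH0 : 0 < H := lt_of_lt_of_le (by positivity) hH
  have hXH : (0 : ℝ) < X * H := by positivity
  have hpi := Real.pi_pos
  have hs0' : (0 : ℝ) < s := by exact_mod_cast hs0
  have hscale : ∀ q, 0 < arcScale X H P s q := fun q => by
    unfold arcScale
    split_ifs <;> positivity
  have hFc : Continuous fun α => formSum a b c X α := by
    unfold formSum
    fun_prop
  have hcont : ∀ q p : ℕ, Continuous fun α : ℝ =>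
      arcWeight X H P s q * cauchyKernel (arcScale X H P s q) (α - p / q) := fun q p => by fun_prop
  have hterm : ∀ q ∈ Finset.Icc 1 (2 * H), ∀ p ∈ Finset.range (q + 1), ∫ α in (0 : ℝ)..1,
      arcWeight X H P s q * cauchyKernel (arcScale X H P s q) (α - p / q) ≤
      98304 * (X * H : ℝ) ^ 3 / q ^ 3 * (8 * Real.pi ^ 2 * s / (X * H) ^ 2 +
        if P < q then 4 * Real.pi / (X * H) else 0) := by
    intro q hq p _
    have hq0 : 0 < q := (Finset.mem_Icc.1 hq).1
    rw [intervalIntegral.integral_const_mul]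
    refine (mul_le_mul_of_nonneg_left (integral_cauchyKernel_le (hscale q) _)
      (arcWeight_nonneg _ _ _ _ _)).trans ?_
    rw [arcWeight, arcScale, mul_assoc]
    refine mul_le_mul_of_nonneg_left ?_ (by positivity)
    split_ifs
    · have : 0 ≤ 8 * Real.pi ^ 2 * s / (X * H : ℝ) ^ 2 := by positivity
      have h1 : (4 : ℝ) * (Real.pi / (X * H)) = 4 * Real.pi / (X * H) := by ring
      linarith
    · rw [add_zero]
      refine le_of_eq ?_
      field_simp
  have hmono : ∫ α in (0 : ℝ)..1, ‖formSum a b c X α‖ ^ 2 * ‖expi (s * α) - 1‖ ^ 2 ≤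
      ∫ α in (0 : ℝ)..1, (minorError X H +
        ∑ q ∈ Finset.Icc 1 (2 * H), ∑ p ∈ Finset.range (q + 1),
          arcWeight X H P s q * cauchyKernel (arcScale X H P s q) (α - p / q)) := by
    refine intervalIntegral.integral_mono_on zero_le_one ?_ ?_ fun α hα =>
      normSq_formSum_mul_le ha hb hc hX hH hs hα
    · exact Continuous.intervalIntegrable (by fun_prop) _ _
    · exact Continuous.intervalIntegrable (by fun_prop) _ _
  refine hmono.trans ?_
  rw [intervalIntegral.integral_add (by simp)
    (Continuous.intervalIntegrable (by fun_prop) _ _), intervalIntegral.integral_const, sub_zero,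
    one_smul, add_assoc, intervalIntegral.integral_finsetSum fun q _ =>
      Continuous.intervalIntegrable (by fun_prop) _ _]
  refine add_le_add_right ?_ _
  calc _ ≤ ∑ q ∈ Finset.Icc 1 (2 * H), ∑ p ∈ Finset.range (q + 1),
        98304 * (X * H : ℝ) ^ 3 / q ^ 3 * (8 * Real.pi ^ 2 * s / (X * H) ^ 2 +
          if P < q then 4 * Real.pi / (X * H) else 0) := by
        refine Finset.sum_le_sum fun q hq => ?_
        rw [intervalIntegral.integral_finsetSum fun p _ => (hcont q p).intervalIntegrable _ _]
        exact Finset.sum_le_sum (hterm q hq)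
    _ ≤ ∑ q ∈ Finset.Icc 1 (2 * H), 98304 * (X * H : ℝ) ^ 3 * 2 * ((q : ℝ) ^ 2)⁻¹ *
          (8 * Real.pi ^ 2 * s / (X * H) ^ 2 + if P < q then 4 * Real.pi / (X * H) else 0) := by
        refine Finset.sum_le_sum fun q hq => ?_
        have hq0 : (1 : ℝ) ≤ q := by exact_mod_cast (Finset.mem_Icc.1 hq).1
        have hcase : (0 : ℝ) ≤ if P < q then 4 * Real.pi / (X * H) else 0 := by
          split_ifs <;> positivity
        rw [Finset.sum_const, Finset.card_range, nsmul_eq_mul, ← mul_assoc]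
        refine mul_le_mul_of_nonneg_right ?_ (by positivity)
        calc ((q + 1 : ℕ) : ℝ) * (98304 * (X * H : ℝ) ^ 3 / q ^ 3)
            ≤ (2 * q) * (98304 * (X * H : ℝ) ^ 3 / q ^ 3) := by
              gcongr; push_cast; linarith
          _ = _ := by field_simp
    _ = 98304 * (16 * Real.pi ^ 2) * (s * (X * H)) *
          ∑ q ∈ Finset.Icc 1 (2 * H), ((q : ℝ) ^ 2)⁻¹ +
        98304 * (8 * Real.pi) * (X * H : ℝ) ^ 2 *
          ∑ q ∈ Finset.Ioc P (2 * H), ((q : ℝ) ^ 2)⁻¹ := by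
        have hfilter : Finset.Ioc P (2 * H) = {q ∈ Finset.Icc 1 (2 * H) | P < q} := by
          ext; simp only [Finset.mem_Ioc, Finset.mem_filter, Finset.mem_Icc]; omega
        rw [hfilter, Finset.sum_filter, Finset.mul_sum, Finset.mul_sum, ← Finset.sum_add_distrib]
        refine Finset.sum_congr rfl fun q _ => ?_
        split_ifs
        · field_simp
          ring
        · field_simp
          ring
    _ ≤ 98304 * (16 * Real.pi ^ 2) * (s * (X * H)) * 2 +
        98304 * (8 * Real.pi) * (X * H : ℝ) ^ 2 * (P : ℝ)⁻¹ := by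
        gcongr
        · exact sum_Icc_inv_sq_le_two _
        · exact sum_Ioc_inv_sq_le_inv hP _
    _ = _ := by ring

lemma integral_expi_intCast_mul (k : ℤ) :
    ∫ α in (0 : ℝ)..1, expi (k * α) = if k = 0 then 1 else 0 := by
  split_ifs with hk
  · simp [hk, expi_zero]
  · have hc : Complex.I * (2 * Real.pi * k) ≠ 0 := by
      simp [Complex.I_ne_zero, Real.pi_ne_zero, hk]
    have h1 : ∀ α : ℝ, expi (k * α) = Complex.exp (Complex.I * (2 * Real.pi * k) * α) := fun α => by
      rw [expi]
      congr 1
      push_cast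
      ring
    simp_rw [h1]
    rw [integral_exp_mul_complex hc]
    have h2 := expi_intCast k
    rw [expi] at h2
    push_cast at h2
    simp [h2]

lemma integral_normSq_sum_expi (D : ℕ → ℝ) (N : ℕ) :
    ∫ α in (0 : ℝ)..1, ‖∑ m ∈ Finset.range N, (D m : ℂ) * expi (m * α)‖ ^ 2 =
      ∑ m ∈ Finset.range N, D m ^ 2 := by
  have hexp : ∀ α : ℝ, ((‖∑ m ∈ Finset.range N, (D m : ℂ) * expi (m * α)‖ ^ 2 : ℝ) : ℂ) =
      ∑ m ∈ Finset.range N, ∑ k ∈ Finset.range N, (D m * D k : ℂ) * expi (((m - k : ℤ) : ℝ) * α) := by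
    intro α
    rw [← Complex.normSq_eq_norm_sq, Complex.normSq_eq_conj_mul_self, mul_comm, map_sum,
      Finset.sum_mul_sum]
    refine Finset.sum_congr rfl fun m _ => Finset.sum_congr rfl fun k _ => ?_
    rw [map_mul, Complex.conj_ofReal, conj_expi, mul_mul_mul_comm, ← expi_add]
    congr 2
    push_cast
    ring
  rw [← Complex.ofReal_inj, ← intervalIntegral.integral_ofReal]
  simp_rw [hexp]
  rw [intervalIntegral.integral_finsetSum fun m _ =>
    Continuous.intervalIntegrable (by fun_prop) _ _]
  push_cast
  refine Finset.sum_congr rfl fun m hm => ?_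
  rw [intervalIntegral.integral_finsetSum fun k _ =>
    Continuous.intervalIntegrable (by fun_prop) _ _]
  simp_rw [intervalIntegral.integral_const_mul]
  rw [Finset.sum_eq_single m]
  · have := integral_expi_intCast_mul (m - m)
    push_cast at this
    rw [this]
    simp [sq]
  · intro k _ hk
    have := integral_expi_intCast_mul (m - k)
    push_cast at this
    rw [this, if_neg (by omega), mul_zero]
  · exact fun h => absurd hm h

lemma formSum_eq_sum_range {a b c X N : ℕ} (hN : ∀ v ∈ cube X, triForm a b c v < N) (α : ℝ) :
    formSum a b c X α = ∑ m ∈ Finset.range N, ((repCount a b c X m : ℝ) : ℂ) * expi (m * α) := by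
  rw [formSum, ← Finset.sum_fiberwise_of_maps_to (t := Finset.range N)
    (g := triForm a b c) fun v hv => Finset.mem_range.2 (hN v hv)]
  refine Finset.sum_congr rfl fun m _ => ?_
  rw [Finset.sum_congr rfl fun v hv => by rw [(Finset.mem_filter.1 hv).2], Finset.sum_const,
    nsmul_eq_mul, repCount, Complex.ofReal_natCast]

lemma formSum_mul_expi_sub_one {a b c X N s : ℕ} (hN : ∀ v ∈ cube X, triForm a b c v < N) (α : ℝ) :
    formSum a b c X α * (expi (s * α) - 1) = ∑ m ∈ Finset.range (s + N),
      (((if s ≤ m then (repCount a b c X (m - s) : ℝ) else 0) - repCount a b c X m : ℝ) : ℂ) *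
        expi (m * α) := by
  have h1 := formSum_eq_sum_range hN α
  have h2 := formSum_eq_sum_range (N := s + N) (fun v hv => (hN v hv).trans_le (by omega)) α
  have h3 : formSum a b c X α * expi (s * α) = ∑ m ∈ Finset.range (s + N),
      ((if s ≤ m then (repCount a b c X (m - s) : ℝ) else 0 : ℝ) : ℂ) * expi (m * α) := by
    rw [Finset.sum_range_add, Finset.sum_eq_zero, zero_add, h1, Finset.sum_mul]
    · refine Finset.sum_congr rfl fun m _ => ?_
      rw [if_pos (by omega), Nat.add_sub_cancel_left, mul_assoc, ← expi_add]
      congr 2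
      push_cast
      ring
    · intro m hm
      rw [Finset.mem_range] at hm
      rw [if_neg (by omega)]
      simp
  rw [mul_sub, mul_one, h3, h2, ← Finset.sum_sub_distrib]
  refine Finset.sum_congr rfl fun m _ => ?_
  push_cast
  ring

theorem sum_sq_repCount_le {a b c X H P s : ℕ} (ha : 0 < a) (hb : 0 < b) (hc : 0 < c)
    (hX : 0 < X) (hH : (2 * a + b + c) * X ≤ H) (hP : 0 < P) (hs0 : 0 < s)
    (hs : ∀ q, 0 < q → q ≤ P → q ∣ s) {E : Finset ℕ} (hE : ∀ n ∈ E, repCount a b c X n = 0) :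
    ∑ n ∈ E, (repCount a b c X (n + s) : ℝ) ^ 2 ≤
      minorError X H + 98304 * (32 * Real.pi ^ 2) * (s * (X * H)) +
        98304 * (8 * Real.pi) * ((X * H : ℝ) ^ 2 / P) := by
  refine le_trans ?_ (integral_normSq_formSum_mul_le ha hb hc hX hH hP hs0 hs)
  set N := (cube X).sup (triForm a b c) + 1 + E.sup id + 1 with hNdef
  have hN : ∀ v ∈ cube X, triForm a b c v < N := fun v hv => by
    have : triForm a b c v ≤ (cube X).sup (triForm a b c) := Finset.le_sup hv
    omega
  simp_rw [← mul_pow, ← norm_mul, formSum_mul_expi_sub_one hN]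
  rw [integral_normSq_sum_expi]
  rw [← Finset.sum_image (s := E) (g := (· + s))
    (f := fun m => (repCount a b c X m : ℝ) ^ 2) (add_left_injective s).injOn]
  have hsub : E.image (· + s) ⊆ Finset.range (s + N) := by
    intro m hm
    obtain ⟨n, hn, rfl⟩ := Finset.mem_image.1 hm
    have : n ≤ E.sup id := Finset.le_sup (f := id) hn
    exact Finset.mem_range.2 (by omega)
  refine le_trans (le_of_eq (Finset.sum_congr rfl fun m hm => ?_))
    (Finset.sum_le_sum_of_subset_of_nonneg hsub fun m _ _ => sq_nonneg _)
  obtain ⟨n, hn, rfl⟩ := Finset.mem_image.1 hm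
  rw [if_pos (by omega), Nat.add_sub_cancel, hE n hn]
  push_cast
  ring

/-! ### Sufficiency -/

lemma half_le_natCast_div {m k : ℕ} (hk : 0 < k) (h : k ≤ m) : (m : ℝ) / k / 2 ≤ ((m / k : ℕ) : ℝ) := by
  have h1 : 1 ≤ m / k := (Nat.le_div_iff_mul_le hk).2 (by omega)
  have h2 := Nat.lt_mul_div_succ m hk
  have h3 : m ≤ 2 * (m / k) * k := by nlinarith
  have hk' : (0 : ℝ) < k := by exact_mod_cast hk
  rw [div_div, div_le_iff₀ (by positivity)]
  have h4 : (m : ℝ) ≤ 2 * ((m / k : ℕ) : ℝ) * k := by exact_mod_cast h3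
  linarith

lemma le_sum_repCount {a b c P u T n : ℕ} (hc : 0 < c) (hgcd : Nat.gcd a (Nat.gcd b c) = 1)
    (ha : isQR (-((b : ℤ) * c)) (oddPart a)) (hb : isQR (-(2 * (a : ℤ) * c)) (oddPart b))
    (hc' : isQR (-(2 * (a : ℤ) * b)) (oddPart c)) (h4 : ¬ 4 ∣ b ∨ ¬ 4 ∣ c)
    (hP : 2 ≤ P) (hu : 0 < u) (hT : 2 * u * P.factorial ≤ T) (hT' : 12 * c * P * P.factorial ≤ T)
    (hn : n < T ^ 2) (hLn : (a + b) * (T / u) ^ 2 ≤ n) :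
    locProd (P + 1) / (96 * c * u ^ 2) * T * (T ^ 2 / (P * P.factorial) : ℕ) ≤
      ∑ j ∈ Finset.Icc 1 (T ^ 2 / (P * P.factorial)),
        (repCount a b c (3 * T) (n + j * P.factorial) : ℝ) := by
  have hW : 0 < P.factorial := P.factorial_pos
  set W := P.factorial with hWdef
  set K := T ^ 2 / (P * W) with hK
  have hPW : 0 < P * W := by positivity
  have hT0 : 0 < T := lt_of_lt_of_le (by positivity) hT
  have hKW : K * (P * W) ≤ T ^ 2 := Nat.div_mul_le_self _ _
  have h2T : 2 * W ≤ T := by nlinarith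
  have h1 := locCount_mul_le_sum_repCount hc hW h2T hn hLn (Nat.div_le_self T u)
    (by nlinarith : K * W ≤ T ^ 2)
  have h2 := le_locCount n hgcd ha hb hc' h4 (V := 2 * W) (by omega)
  rw [prod_primeFactors_two_mul_factorial hP] at h2
  have h3 : (T : ℝ) / (4 * u * W) ≤ ((T / u / (2 * W) : ℕ) : ℝ) := by
    rw [Nat.div_div_eq_div_mul]
    refine le_trans (le_of_eq ?_) (half_le_natCast_div (by positivity) (by linarith))
    push_cast
    rw [div_div]
    ring
  have h6 : 6 * c * T ≤ K := by
    rw [hK, Nat.le_div_iff_mul_le hPW]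
    nlinarith
  have h7 : (K : ℝ) / (12 * c * T) ≤ ((K * W / (3 * c * (2 * W) * T) : ℕ) : ℝ) := by
    have h8 : K * W / (3 * c * (2 * W) * T) = K / (6 * c * T) := by
      rw [show 3 * c * (2 * W) * T = 6 * c * T * W by ring, Nat.mul_div_mul_right _ _ hW]
    rw [h8]
    refine le_trans (le_of_eq ?_) (half_le_natCast_div (by positivity) h6)
    push_cast
    rw [div_div]
    ring
  have hlp := locProd_nonneg (P + 1)
  have hc0 : (c : ℝ) ≠ 0 := by exact_mod_cast hc.ne'
  have hu0 : (u : ℝ) ≠ 0 := by exact_mod_cast hu.ne'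
  have hW0 : (W : ℝ) ≠ 0 := by exact_mod_cast hW.ne'
  have hT0' : (T : ℝ) ≠ 0 := by exact_mod_cast hT0.ne'
  have h9 : ((locCount a b c n (2 * W) : ℝ) * ((T / u / (2 * W) : ℕ) : ℝ) ^ 2 *
      ((K * W / (3 * c * (2 * W) * T) : ℕ) : ℝ)) ≤
      ∑ j ∈ Finset.Icc 1 K, (repCount a b c (3 * T) (n + j * W) : ℝ) := by exact_mod_cast h1
  refine le_trans ?_ h9
  calc locProd (P + 1) / (96 * c * u ^ 2) * T * K ≤
      locProd (P + 1) / (48 * c * u ^ 2) * T * K := by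
        gcongr
        norm_num
    _ = ((2 * W : ℕ) : ℝ) ^ 2 * locProd (P + 1) * (T / (4 * u * W)) ^ 2 * (K / (12 * c * T)) := by
        push_cast
        field_simp
        ring
    _ ≤ _ := by gcongr

/-- The constant in the bound for the mean square of the representation numbers. -/
noncomputable def majorConst (D : ℕ) : ℝ :=
  98304 * (32 * Real.pi ^ 2) * (9 * D) + 98304 * (8 * Real.pi) * (81 * D ^ 2)

lemma majorConst_pos {D : ℕ} (hD : 0 < D) : 0 < majorConst D := by
  unfold majorConst
  positivity

lemma card_mul_sq_le {a b c P u T : ℕ} (ha0 : 0 < a) (hb0 : 0 < b) (hc0 : 0 < c)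
    (hgcd : Nat.gcd a (Nat.gcd b c) = 1)
    (ha : isQR (-((b : ℤ) * c)) (oddPart a)) (hb : isQR (-(2 * (a : ℤ) * c)) (oddPart b))
    (hc : isQR (-(2 * (a : ℤ) * b)) (oddPart c)) (h4 : ¬ 4 ∣ b ∨ ¬ 4 ∣ c)
    (hP : 2 ≤ P) (hu : 0 < u) (hT : 2 * u * P.factorial ≤ T)
    (hT' : 12 * c * P * P.factorial ≤ T) {E : Finset ℕ}
    (hE : ∀ n ∈ E, n < T ^ 2 ∧ (a + b) * (T / u) ^ 2 ≤ n ∧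
      ¬ ∃ x y z : ℕ, a * x ^ 2 + b * triangular y + c * triangular z = n) :
    (E.card : ℝ) * (locProd (P + 1) / (96 * c * u ^ 2) * T) ^ 2 ≤
      minorError (3 * T) ((2 * a + b + c) * (3 * T)) +
        majorConst (2 * a + b + c) * (T ^ 4 / P) := by
  set D := 2 * a + b + c with hD
  set W := P.factorial with hW
  set K := T ^ 2 / (P * W) with hK
  set η := locProd (P + 1) / (96 * c * u ^ 2) * T with hη
  have hW0 : 0 < W := P.factorial_pos
  have hPW : 0 < P * W := by positivity
  have hT0 : 0 < T := lt_of_lt_of_le (by positivity) hT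
  have hη0 : 0 ≤ η := by
    have := locProd_nonneg (P + 1)
    positivity
  have hK0 : 0 < K := by
    refine Nat.div_pos ?_ hPW
    nlinarith [Nat.mul_le_mul_right (P * W) (by omega : 1 ≤ 12 * c)]
  have hKW : K * (P * W) ≤ T ^ 2 := Nat.div_mul_le_self _ _
  have hK0' : (0 : ℝ) < K := by exact_mod_cast hK0
  have hP0 : (0 : ℝ) < P := by exact_mod_cast (by omega : 0 < P)
  have hlow : ∀ n ∈ E, K * η ^ 2 ≤
      ∑ j ∈ Finset.Icc 1 K, (repCount a b c (3 * T) (n + j * W) : ℝ) ^ 2 := by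
    intro n hn
    obtain ⟨h1, h2, -⟩ := hE n hn
    have h3 := le_sum_repCount hc0 hgcd ha hb hc h4 hP hu hT hT' h1 h2
    have h4 := sq_sum_le_card_mul_sum_sq (s := Finset.Icc 1 K)
      (f := fun j => (repCount a b c (3 * T) (n + j * W) : ℝ))
    rw [Nat.card_Icc, Nat.add_sub_cancel] at h4
    have h5 : (η * K) ^ 2 ≤ _ := (pow_le_pow_left₀ (by positivity) h3 2).trans h4
    refine le_of_mul_le_mul_left ?_ hK0'
    calc (K : ℝ) * (K * η ^ 2) = (η * K) ^ 2 := by ring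
      _ ≤ _ := h5
  have hup : ∀ j ∈ Finset.Icc 1 K,
      ∑ n ∈ E, (repCount a b c (3 * T) (n + j * W) : ℝ) ^ 2 ≤
        minorError (3 * T) (D * (3 * T)) + majorConst D * (T ^ 4 / P) := by
    intro j hj
    rw [Finset.mem_Icc] at hj
    have h1 := sum_sq_repCount_le (P := P) (s := j * W) (E := E) ha0 hb0 hc0
      (by positivity : 0 < 3 * T) (le_refl _) (by omega)
      (Nat.mul_pos (by omega) hW0)
      (fun q hq hqP => (Nat.dvd_factorial hq hqP).mul_left j) (by
        intro n hn
        rw [repCount, Finset.card_eq_zero, Finset.filter_eq_empty_iff]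
        intro v _ hv
        exact (hE n hn).2.2 ⟨v.1, v.2.1, v.2.2, hv⟩)
    refine h1.trans ?_
    have h2 : ((j * W : ℕ) : ℝ) ≤ T ^ 2 / P := by
      rw [le_div_iff₀ hP0]
      have : j * W * P ≤ T ^ 2 := by nlinarith [Nat.mul_le_mul_right (P * W) hj.2]
      exact_mod_cast this
    rw [add_assoc]
    refine add_le_add_right ?_ _
    rw [← hD]
    calc 98304 * (32 * Real.pi ^ 2) * (((j * W : ℕ) : ℝ) *
          (((3 * T : ℕ) : ℝ) * ((D * (3 * T) : ℕ) : ℝ))) +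
          98304 * (8 * Real.pi) * ((((3 * T : ℕ) : ℝ) * ((D * (3 * T) : ℕ) : ℝ)) ^ 2 / P)
        ≤ 98304 * (32 * Real.pi ^ 2) * (T ^ 2 / P *
          (((3 * T : ℕ) : ℝ) * ((D * (3 * T) : ℕ) : ℝ))) +
          98304 * (8 * Real.pi) *
            ((((3 * T : ℕ) : ℝ) * ((D * (3 * T) : ℕ) : ℝ)) ^ 2 / P) := by gcongr
      _ = majorConst D * (T ^ 4 / P) := by
        unfold majorConst
        push_cast
        field_simp
        ring
  have hsum : (E.card : ℝ) * (K * η ^ 2) ≤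
      K * (minorError (3 * T) (D * (3 * T)) + majorConst D * (T ^ 4 / P)) := by
    have h1 := Finset.card_nsmul_le_sum E _ _ hlow
    rw [nsmul_eq_mul, Finset.sum_comm] at h1
    refine h1.trans ((Finset.sum_le_card_nsmul _ _ _ hup).trans (le_of_eq ?_))
    rw [nsmul_eq_mul, Nat.card_Icc, Nat.add_sub_cancel]
  refine le_of_mul_le_mul_left ?_ hK0'
  calc (K : ℝ) * (E.card * η ^ 2) = E.card * (K * η ^ 2) := by ring
    _ ≤ _ := hsum

open Filter Topology in
lemma tendsto_minorError_div {D : ℕ} (hD : 0 < D) :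
    Tendsto (fun T : ℕ => minorError (3 * T) (D * (3 * T)) / (T : ℝ) ^ 4) atTop (𝓝 0) := by
  have hD' : (0 : ℝ) < D := by exact_mod_cast hD
  set κ : ℝ := Real.exp 1 * (6 * D) with hκ
  have hκ0 : 0 < κ := by positivity
  have hlin : Tendsto (fun T : ℕ => κ * (T : ℝ)) atTop atTop :=
    tendsto_natCast_atTop_atTop.const_mul_atTop hκ0
  have h1 : Tendsto (fun T : ℕ => Real.log (κ * T) ^ 3 / (κ * T)) atTop (𝓝 0) :=
    (Real.isLittleO_pow_log_id_atTop (n := 3)).tendsto_div_nhds_zero.comp hlin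
  have h2 : Tendsto (fun T : ℕ => 432 / (T : ℝ) +
      4096 * (36 * D) ^ 3 * κ * (Real.log (κ * T) ^ 3 / (κ * T))) atTop (𝓝 0) := by
    simpa using (tendsto_const_div_atTop_nhds_zero_nat (432 : ℝ)).add
      (h1.const_mul (4096 * (36 * (D : ℝ)) ^ 3 * κ))
  refine h2.congr' ?_
  filter_upwards [eventually_gt_atTop 0] with T hT
  have hT' : (0 : ℝ) < T := by exact_mod_cast hT
  have hlog : Real.log (κ * T) = 1 + Real.log (2 * ((D * (3 * T) : ℕ) : ℝ)) := by
    rw [show κ * T = Real.exp 1 * (2 * ((D * (3 * T) : ℕ) : ℝ)) by rw [hκ]; push_cast; ring,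
      Real.log_mul (Real.exp_pos 1).ne' (by positivity), Real.log_exp]
  rw [hlog, minorError]
  generalize Real.log (2 * ((D * (3 * T) : ℕ) : ℝ)) = l
  push_cast
  field_simp
  ring

lemma ncard_exceptional_le {a b c P u N T : ℕ} (ha0 : 0 < a) (hb0 : 0 < b) (hc0 : 0 < c)
    (hgcd : Nat.gcd a (Nat.gcd b c) = 1)
    (ha : isQR (-((b : ℤ) * c)) (oddPart a)) (hb : isQR (-(2 * (a : ℤ) * c)) (oddPart b))
    (hc : isQR (-(2 * (a : ℤ) * b)) (oddPart c)) (h4 : ¬ 4 ∣ b ∨ ¬ 4 ∣ c)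
    (hP : 2 ≤ P) (hu : 0 < u) (hT : 2 * u * P.factorial ≤ T)
    (hT' : 12 * c * P * P.factorial ≤ T) (hN : N ≤ T ^ 2) :
    (({n : ℕ | n < N ∧ ¬ ∃ x y z : ℕ,
      a * x ^ 2 + b * triangular y + c * triangular z = n}.ncard : ℕ) : ℝ) ≤
      (a + b) / u ^ 2 * T ^ 2 +
      (minorError (3 * T) ((2 * a + b + c) * (3 * T)) / T ^ 4 +
        majorConst (2 * a + b + c) / P) / (locProd (P + 1) / (96 * c * u ^ 2)) ^ 2 * T ^ 2 := by
  classical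
  set sol : ℕ → Prop := fun n => ∃ x y z : ℕ,
    a * x ^ 2 + b * triangular y + c * triangular z = n with hsol
  set E : Finset ℕ := {n ∈ Finset.range (T ^ 2) | (a + b) * (T / u) ^ 2 ≤ n ∧ ¬ sol n} with hE
  have hT0 : 0 < T := lt_of_lt_of_le (Nat.mul_pos (by omega) P.factorial_pos) hT
  have hT0' : (0 : ℝ) < T := by exact_mod_cast hT0
  have hu0 : (0 : ℝ) < u := by exact_mod_cast hu
  have hc0' : (0 : ℝ) < c := by exact_mod_cast hc0
  have hlp := locProd_pos (P + 1)
  have hsub : {n : ℕ | n < N ∧ ¬ sol n} ⊆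
      ((Finset.range ((a + b) * (T / u) ^ 2) ∪ E : Finset ℕ) : Set ℕ) := by
    rintro n ⟨hn, hs⟩
    simp only [Finset.coe_union, Set.mem_union, Finset.mem_coe, Finset.mem_range, hE,
      Finset.mem_filter]
    by_cases h : n < (a + b) * (T / u) ^ 2
    · exact Or.inl h
    · exact Or.inr ⟨by omega, by omega, hs⟩
  have hcard : {n : ℕ | n < N ∧ ¬ sol n}.ncard ≤ (a + b) * (T / u) ^ 2 + E.card := by
    refine (Set.ncard_le_ncard hsub (Finset.finite_toSet _)).trans ?_
    rw [Set.ncard_coe_finset]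
    refine (Finset.card_union_le _ _).trans ?_
    rw [Finset.card_range]
  have hmain := card_mul_sq_le (E := E) ha0 hb0 hc0 hgcd ha hb hc h4 hP hu hT hT' (by
    intro n hn
    rw [hE, Finset.mem_filter, Finset.mem_range] at hn
    exact hn)
  calc (({n : ℕ | n < N ∧ ¬ sol n}.ncard : ℕ) : ℝ)
      ≤ (((a + b) * (T / u) ^ 2 + E.card : ℕ) : ℝ) := by exact_mod_cast hcard
    _ = (a + b) * ((T / u : ℕ) : ℝ) ^ 2 + E.card := by push_cast; ring
    _ ≤ _ := by
      refine add_le_add ?_ ?_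
      · calc ((a : ℝ) + b) * ((T / u : ℕ) : ℝ) ^ 2 ≤ (a + b) * ((T : ℝ) / u) ^ 2 := by
              gcongr
              exact Nat.cast_div_le
          _ = _ := by ring
      · rw [div_mul_eq_mul_div, le_div_iff₀ (by positivity)]
        refine le_of_mul_le_mul_right ?_ (by positivity : (0 : ℝ) < T ^ 2)
        calc (E.card : ℝ) * (locProd (P + 1) / (96 * c * u ^ 2)) ^ 2 * T ^ 2 =
            E.card * (locProd (P + 1) / (96 * c * u ^ 2) * T) ^ 2 := by ring
          _ ≤ _ := hmain
          _ = _ := by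
            field_simp

open Filter Topology in
theorem asympUniversal_of_local_conditions {a b c : ℕ} (ha0 : 0 < a) (hb0 : 0 < b) (hc0 : 0 < c)
    (hgcd : Nat.gcd a (Nat.gcd b c) = 1)
    (ha : isQR (-((b : ℤ) * c)) (oddPart a)) (hb : isQR (-(2 * (a : ℤ) * c)) (oddPart b))
    (hc : isQR (-(2 * (a : ℤ) * b)) (oddPart c)) (h4 : ¬ 4 ∣ b ∨ ¬ 4 ∣ c) :
    AsympUniversal (fun n => ∃ x y z : ℕ,
      a * x ^ 2 + b * triangular y + c * triangular z = n) := by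
  rw [AsympUniversal, Metric.tendsto_atTop]
  intro ε hε
  set D := 2 * a + b + c with hD
  have hD0 : 0 < D := by omega
  have hC := majorConst_pos hD0
  have hc0' : (0 : ℝ) < c := by exact_mod_cast hc0
  obtain ⟨u, hu⟩ := exists_nat_gt (16 * ((a : ℝ) + b) / ε)
  have hu0 : (0 : ℝ) < u := lt_of_le_of_lt (by positivity) hu
  have hu0' : 0 < u := by exact_mod_cast hu0
  have hu1 : (1 : ℝ) ≤ u := by exact_mod_cast hu0'
  obtain ⟨P, hP, hM⟩ := exists_le_locProd_sq_mul
    (16 * majorConst D * (96 * c * u ^ 2) ^ 2 / ε)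
  have hP0 : (0 : ℝ) < P := by exact_mod_cast (by omega : 0 < P)
  have hlp := locProd_pos (P + 1)
  set η := locProd (P + 1) / (96 * c * u ^ 2) with hη
  have hη0 : 0 < η := by positivity
  have hsmall : ((a : ℝ) + b) / u ^ 2 ≤ ε / 16 := by
    rw [div_lt_iff₀ hε] at hu
    rw [div_le_div_iff₀ (by positivity) (by norm_num)]
    nlinarith [mul_le_mul_of_nonneg_left hu1 (mul_pos hu0 hε).le]
  have hmajor : majorConst D / P / η ^ 2 ≤ ε / 16 := by
    rw [div_le_iff₀ hε] at hM
    rw [hη, div_pow, div_div, div_le_iff₀ (by positivity), mul_div_assoc', mul_div_assoc',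
      le_div_iff₀ (by positivity)]
    linarith
  obtain ⟨T₀, hT₀⟩ := (Metric.tendsto_atTop.1 (tendsto_minorError_div hD0)) (ε / 16 * η ^ 2)
    (by positivity)
  refine ⟨(T₀ + 2 * u * P.factorial + 12 * c * P * P.factorial + 1) ^ 2, fun N hN => ?_⟩
  set T := Nat.sqrt N + 1 with hT
  have hsqrt : T₀ + 2 * u * P.factorial + 12 * c * P * P.factorial + 1 ≤ Nat.sqrt N :=
    Nat.le_sqrt'.2 hN
  have hNT : N < T ^ 2 := Nat.lt_succ_sqrt' N
  have hTN : T ^ 2 ≤ 4 * N := by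
    calc T ^ 2 ≤ (2 * Nat.sqrt N) ^ 2 := Nat.pow_le_pow_left (by omega) 2
      _ = 4 * Nat.sqrt N ^ 2 := by ring
      _ ≤ 4 * N := Nat.mul_le_mul_left 4 (Nat.sqrt_le' N)
  have hN0 : 0 < N := by nlinarith
  have hN0' : (0 : ℝ) < N := by exact_mod_cast hN0
  have hTN' : (T : ℝ) ^ 2 ≤ 4 * N := by exact_mod_cast hTN
  have hcount := ncard_exceptional_le ha0 hb0 hc0 hgcd ha hb hc h4 hP hu0'
    (show 2 * u * P.factorial ≤ T by omega) (show 12 * c * P * P.factorial ≤ T by omega) hNT.le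
  have hminor := hT₀ T (by omega)
  rw [Real.dist_eq, sub_zero] at hminor
  have hminor' : minorError (3 * T) (D * (3 * T)) / T ^ 4 / η ^ 2 ≤ ε / 16 := by
    rw [div_le_iff₀ (by positivity)]
    exact (lt_of_abs_lt hminor).le
  rw [Real.dist_eq, sub_zero, abs_of_nonneg (by positivity), div_lt_iff₀ hN0']
  refine hcount.trans_lt ?_
  rw [← hη, ← hD, add_div _ _ (η ^ 2)]
  calc _ ≤ ε / 16 * (T : ℝ) ^ 2 + (ε / 16 + ε / 16) * (T : ℝ) ^ 2 := by gcongr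
    _ = 3 * ε / 16 * (T : ℝ) ^ 2 := by ring
    _ ≤ 3 * ε / 16 * (4 * N) := by gcongr
    _ < ε * N := by nlinarith [mul_pos hε hN0']

/-- Kane–Sun: `a·x² + b·t_y + c·t_z` is asymptotically universal iff
`-bc R a'`, `-2ac R b'`, `-2ab R c'`, and `4 ∤ b` or `4 ∤ c`. -/
theorem asympUniversal_square_two_triangular_iff (a b c : ℕ)
    (ha : 0 < a) (hb : 0 < b) (hc : 0 < c)
    (hgcd : Nat.gcd a (Nat.gcd b c) = 1) :
    AsympUniversal (fun n => ∃ x y z : ℕ,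
        a * x ^ 2 + b * triangular y + c * triangular z = n) ↔
      ((isQR (-((b : ℤ) * c)) (oddPart a) ∧
          isQR (-(2 * (a : ℤ) * c)) (oddPart b) ∧
          isQR (-(2 * (a : ℤ) * b)) (oddPart c)) ∧
        (¬ (4 ∣ b) ∨ ¬ (4 ∣ c))) := by
  exact ⟨local_conditions_of_asympUniversal ha hb hc hgcd,
    fun h => asympUniversal_of_local_conditions ha hb hc hgcd h.1.1 h.1.2.1 h.1.2.2 h.2⟩
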